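/- Let 𝒳 and 𝒴 be countably generated LFCM spaces such that 𝒜(𝒳) contains a faithful 𝒳-module and 𝒜(𝒴) contains a faithful 𝒴-module, and let F : 𝒜(𝒳) → 𝒜(𝒴) be a full and faithful *-functor. Then there exists a coarse embedding f^F : 𝒳 → 𝒴, unique up to closeness, such that for every faithful coarse 𝒳-module C, every unitary U(C) : H_C → H_{F(C)} implementing the *-isomorphism End_{𝒜(𝒳)}(C) → End_{𝒜(𝒴)}(F(C)) induced by F, every δ ∈ (0,1), and all sufficiently large entourages F' ∈ 𝓔^Y and E ∈ 𝓔^X, the approximate relation f^{U(C)}_{δ,F',E} is asymptotically equivalent to the graph of f^F. Moreover, if F is a *-equivalence of categories, then f^F is a coarse equivalence. -/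

import Mathlib

noncomputable section

open scoped ENNReal

/-! ## Relations -/

/-- Composition of relations: for `R ⊆ Z × Y` and `S ⊆ Y × X`,
`RelComp R S = {(z,x) | ∃ y, (z,y) ∈ R ∧ (y,x) ∈ S}`. -/
def RelComp {X Y Z : Type} (R : Set (Z × Y)) (S : Set (Y × X)) : Set (Z × X) :=
  {p | ∃ y, (p.1, y) ∈ R ∧ (y, p.2) ∈ S}

/-- Transpose of a relation. -/
def RelTrans {X Y : Type} (R : Set (Y × X)) : Set (X × Y) := {p | (p.2, p.1) ∈ R}

/-! ## Coarse spaces -/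

/-- A coarse structure on a set `X`. -/
structure CoarseSpace (X : Type) where
  entourages : Set (Set (X × X))
  diagonal_mem : {p : X × X | p.1 = p.2} ∈ entourages
  mem_of_subset : ∀ {E F : Set (X × X)}, E ∈ entourages → F ⊆ E → F ∈ entourages
  union_mem : ∀ {E F : Set (X × X)}, E ∈ entourages → F ∈ entourages → E ∪ F ∈ entourages
  transpose_mem : ∀ {E : Set (X × X)}, E ∈ entourages → RelTrans E ∈ entourages
  comp_mem : ∀ {E F : Set (X × X)}, E ∈ entourages → F ∈ entourages → RelComp E F ∈ entourages

namespace CoarseSpace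

variable {X Y : Type}

/-- A gauge: a symmetric entourage containing the diagonal. -/
def IsGauge (C : CoarseSpace X) (E : Set (X × X)) : Prop :=
  E ∈ C.entourages ∧ RelTrans E = E ∧ {p : X × X | p.1 = p.2} ⊆ E

/-- The `E`-neighbourhood `E[A]` of a set `A`. -/
def nbhd (E : Set (X × X)) (A : Set X) : Set X := {x | ∃ a ∈ A, (x, a) ∈ E}

/-- A set is bounded if `A × A` is contained in some entourage. -/
def IsBounded (C : CoarseSpace X) (A : Set X) : Prop := ∃ E ∈ C.entourages, A ×ˢ A ⊆ E

/-- `A ≺ B` : `A` is subordinate to `B`. -/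
def Subordinate (C : CoarseSpace X) (A B : Set X) : Prop := ∃ E ∈ C.entourages, A ⊆ nbhd E B

/-- `A ≍ B` : asymptotic equivalence of subsets. -/
def Asymptotic (C : CoarseSpace X) (A B : Set X) : Prop :=
  C.Subordinate A B ∧ C.Subordinate B A

/-- A coarse map between coarse spaces. -/
def IsCoarseMap (CX : CoarseSpace X) (CY : CoarseSpace Y) (f : X → Y) : Prop :=
  ∀ E ∈ CX.entourages, (fun p : X × X => (f p.1, f p.2)) '' E ∈ CY.entourages

/-- Two maps are close. -/
def Close (CX : CoarseSpace X) (CY : CoarseSpace Y) (f g : X → Y) : Prop :=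
  ∀ E ∈ CX.entourages, (fun p : X × X => (f p.1, g p.2)) '' E ∈ CY.entourages

/-- A coarse equivalence (of maps). -/
def IsCoarseEquivMap (CX : CoarseSpace X) (CY : CoarseSpace Y) (f : X → Y) : Prop :=
  IsCoarseMap CX CY f ∧ ∃ g : Y → X, IsCoarseMap CY CX g ∧
    Close CY CY (f ∘ g) id ∧ Close CX CX (g ∘ f) id

/-- A coarse embedding: a coarse map which is in addition expansive (equivalently, a coarse
equivalence onto its image with the subspace coarse structure). -/
def IsCoarseEmbedding (CX : CoarseSpace X) (CY : CoarseSpace Y) (f : X → Y) : Prop :=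
  IsCoarseMap CX CY f ∧
    ∀ F ∈ CY.entourages, {p : X × X | (f p.1, f p.2) ∈ F} ∈ CX.entourages

/-- A coarse structure is countably generated if it is the smallest coarse structure
containing some countable family of subsets of `X × X`. -/
def IsCountablyGenerated (C : CoarseSpace X) : Prop :=
  ∃ G : Set (Set (X × X)), G.Countable ∧ G ⊆ C.entourages ∧
    ∀ C' : CoarseSpace X, G ⊆ C'.entourages → C.entourages ⊆ C'.entourages

end CoarseSpace

/-- Subordination of relations `R₁, R₂ ⊆ Y × X` with respect to the product coarse structure. -/
def RelSub {X Y : Type} (CX : CoarseSpace X) (CY : CoarseSpace Y)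
    (R₁ R₂ : Set (Y × X)) : Prop :=
  ∃ F ∈ CY.entourages, ∃ E ∈ CX.entourages,
    ∀ p ∈ R₁, ∃ q ∈ R₂, (p.1, q.1) ∈ F ∧ (p.2, q.2) ∈ E

/-- Asymptotic equivalence of relations `R₁, R₂ ⊆ Y × X`. -/
def RelAsymp {X Y : Type} (CX : CoarseSpace X) (CY : CoarseSpace Y)
    (R₁ R₂ : Set (Y × X)) : Prop :=
  RelSub CX CY R₁ R₂ ∧ RelSub CX CY R₂ R₁

/-! ## LFCM spaces -/

/-- A discrete partition of a coarse space endowed with a Boolean algebra `meas` of subsets: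
a measurable, locally finite, controlled partition `P` such that a set is measurable iff its
intersection with every block is measurable. -/
structure IsDiscretePartition {X : Type} (C : CoarseSpace X) (meas : Set (Set X))
    (P : Set (Set X)) : Prop where
  nonempty : ∀ A ∈ P, A.Nonempty
  pairwiseDisjoint : ∀ A ∈ P, ∀ B ∈ P, A ≠ B → Disjoint A B
  covers : ⋃₀ P = Set.univ
  measurable : P ⊆ meas
  locallyFinite : ∀ B : Set X, C.IsBounded B → {A | A ∈ P ∧ (A ∩ B).Nonempty}.Finite
  controlled : ∃ E, C.IsGauge E ∧ ∀ A ∈ P, A ×ˢ A ⊆ E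
  meas_iff : ∀ B : Set X, B ∈ meas ↔ ∀ A ∈ P, B ∩ A ∈ meas

/-- A locally finite coarse measurable (LFCM) space: a coarse space together with a Boolean
algebra of subsets admitting a discrete partition (a chosen one is part of the data). -/
structure LFCMSpace (X : Type) where
  coarse : CoarseSpace X
  meas : Set (Set X)
  empty_mem : ∅ ∈ meas
  compl_mem : ∀ {A : Set X}, A ∈ meas → Aᶜ ∈ meas
  union_mem : ∀ {A B : Set X}, A ∈ meas → B ∈ meas → A ∪ B ∈ meas
  partition : Set (Set X)
  isPartition : IsDiscretePartition coarse meas partition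

namespace LFCMSpace

variable {X Y : Type}

/-- The discreteness gauge `E_disc = ⊔_{A ∈ P} A × A` of an LFCM space. -/
def disc (𝒳 : LFCMSpace X) : Set (X × X) := ⋃ A ∈ 𝒳.partition, A ×ˢ A

/-- A discreteness gauge: a gauge bounding the blocks of some discrete partition. -/
def IsDiscretenessGauge (𝒳 : LFCMSpace X) (E : Set (X × X)) : Prop :=
  𝒳.coarse.IsGauge E ∧
    ∃ P, IsDiscretePartition 𝒳.coarse 𝒳.meas P ∧ ∀ A ∈ P, A ×ˢ A ⊆ E

end LFCMSpace

/-- A coarse measurable map between LFCM spaces. -/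
def IsCoarseMeasurableMap {X Y : Type} (𝒳 : LFCMSpace X) (𝒴 : LFCMSpace Y) (f : X → Y) : Prop :=
  CoarseSpace.IsCoarseMap 𝒳.coarse 𝒴.coarse f ∧ ∀ B ∈ 𝒴.meas, f ⁻¹' B ∈ 𝒳.meas

/-! ## Coarse geometric modules -/

/-- A coarse geometric module over an LFCM space `𝒳`: a representation of the Boolean algebra
of measurable sets by orthogonal projections on a complex Hilbert space, nondegenerate on
bounded sets. -/
structure CoarseModule {X : Type} (𝒳 : LFCMSpace X) (H : Type) [NormedAddCommGroup H]
    [InnerProductSpace ℂ H] [CompleteSpace H] where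
  proj : Set X → (H →L[ℂ] H)
  proj_empty : proj ∅ = 0
  proj_selfAdjoint : ∀ A ∈ 𝒳.meas, IsSelfAdjoint (proj A)
  proj_inter : ∀ {A B : Set X}, A ∈ 𝒳.meas → B ∈ 𝒳.meas → proj (A ∩ B) = proj A ∘L proj B
  proj_union : ∀ {A B : Set X}, A ∈ 𝒳.meas → B ∈ 𝒳.meas → Disjoint A B →
      proj (A ∪ B) = proj A + proj B
  nondeg : Dense (↑(Submodule.span ℂ
      (⋃ A ∈ {A | A ∈ 𝒳.meas ∧ 𝒳.coarse.IsBounded A}, Set.range (proj A))) : Set H)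

variable {X Y Z : Type}
variable {H₀ H₁ H₂ H₃ : Type}

/-- The support of a bounded operator between Hilbert spaces carrying representations
`pX`, `pY` of the measurable sets of LFCM spaces `𝒳` (source) and `𝒴` (target). -/
def opSupp [NormedAddCommGroup H₁] [InnerProductSpace ℂ H₁]
    [NormedAddCommGroup H₂] [InnerProductSpace ℂ H₂]
    (𝒳 : LFCMSpace X) (𝒴 : LFCMSpace Y)
    (pX : Set X → (H₁ →L[ℂ] H₁)) (pY : Set Y → (H₂ →L[ℂ] H₂))
    (t : H₁ →L[ℂ] H₂) : Set (Y × X) :=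
  ⋃₀ {S | ∃ B A, S = B ×ˢ A ∧ B ∈ 𝒴.meas ∧ B ×ˢ B ⊆ 𝒴.disc ∧
      A ∈ 𝒳.meas ∧ A ×ˢ A ⊆ 𝒳.disc ∧ pY B ∘L t ∘L pX A ≠ 0}

/-- Controlled propagation of an operator between modules over the same LFCM space. -/
def HasControlledPropagation [NormedAddCommGroup H₁] [InnerProductSpace ℂ H₁]
    [NormedAddCommGroup H₂] [InnerProductSpace ℂ H₂]
    (𝒳 : LFCMSpace X) (pX : Set X → (H₁ →L[ℂ] H₁)) (pY : Set X → (H₂ →L[ℂ] H₂))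
    (t : H₁ →L[ℂ] H₂) : Prop :=
  opSupp 𝒳 𝒳 pX pY t ∈ 𝒳.coarse.entourages

/-- Approximable operators: norm-limits of controlled propagation operators. -/
def Approximable [NormedAddCommGroup H₁] [InnerProductSpace ℂ H₁]
    [NormedAddCommGroup H₂] [InnerProductSpace ℂ H₂]
    (𝒳 : LFCMSpace X) (pX : Set X → (H₁ →L[ℂ] H₁)) (pY : Set X → (H₂ →L[ℂ] H₂))
    (t : H₁ →L[ℂ] H₂) : Prop :=
  ∀ ε : ℝ, 0 < ε → ∃ s : H₁ →L[ℂ] H₂, HasControlledPropagation 𝒳 pX pY s ∧ ‖t - s‖ ≤ ε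

/-- The rank (Hilbert dimension of the range) of an operator. -/
def projRank {H : Type} [NormedAddCommGroup H] [InnerProductSpace ℂ H]
    (p : H →L[ℂ] H) : Cardinal :=
  LinearMap.rank (p : H →ₗ[ℂ] H)

/-- The `κ`-domain of a coarse module, computed with respect to an arbitrary gauge `E`. -/
def domKappaAt {X : Type} {H : Type} [NormedAddCommGroup H] [InnerProductSpace ℂ H]
    [CompleteSpace H] (𝒳 : LFCMSpace X) (M : CoarseModule 𝒳 H) (E : Set (X × X))
    (κ : Cardinal) : Set X :=
  ⋃₀ {A | A ∈ 𝒳.meas ∧ A ×ˢ A ⊆ E ∧ κ ≤ projRank (M.proj A)}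

/-- The `κ`-domain of a coarse module (with respect to the discreteness gauge). -/
def domKappa {X : Type} {H : Type} [NormedAddCommGroup H] [InnerProductSpace ℂ H]
    [CompleteSpace H] (𝒳 : LFCMSpace X) (M : CoarseModule 𝒳 H) (κ : Cardinal) : Set X :=
  domKappaAt 𝒳 M 𝒳.disc κ

/-- A coarse module is faithful if its faithfulness domain is asymptotic to the whole space. -/
def IsFaithfulMod {X : Type} {H : Type} [NormedAddCommGroup H] [InnerProductSpace ℂ H]
    [CompleteSpace H] (𝒳 : LFCMSpace X) (M : CoarseModule 𝒳 H) : Prop :=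
  𝒳.coarse.Asymptotic (domKappa 𝒳 M 1) Set.univ

/-- A coarse module is ample if its ampleness domain is asymptotic to the whole space. -/
def IsAmpleMod {X : Type} {H : Type} [NormedAddCommGroup H] [InnerProductSpace ℂ H]
    [CompleteSpace H] (𝒳 : LFCMSpace X) (M : CoarseModule 𝒳 H) : Prop :=
  𝒳.coarse.Asymptotic (domKappa 𝒳 M Cardinal.aleph0) Set.univ

/-- The approximate relation `f^T_{δ,F,E}` of a bounded operator. -/
def approxRel [NormedAddCommGroup H₁] [InnerProductSpace ℂ H₁]
    [NormedAddCommGroup H₂] [InnerProductSpace ℂ H₂]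
    (𝒳 : LFCMSpace X) (𝒴 : LFCMSpace Y)
    (pX : Set X → (H₁ →L[ℂ] H₁)) (pY : Set Y → (H₂ →L[ℂ] H₂))
    (T : H₁ →L[ℂ] H₂) (δ : ℝ) (F : Set (Y × Y)) (E : Set (X × X)) : Set (Y × X) :=
  ⋃₀ {S | ∃ B A, S = B ×ˢ A ∧ B ∈ 𝒴.meas ∧ B ×ˢ B ⊆ F ∧
      A ∈ 𝒳.meas ∧ A ×ˢ A ⊆ E ∧ δ < ‖pY B ∘L T ∘L pX A‖}

/-- A unitary operator between Hilbert spaces. -/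
def IsUnitaryOp [NormedAddCommGroup H₁] [InnerProductSpace ℂ H₁] [CompleteSpace H₁]
    [NormedAddCommGroup H₂] [InnerProductSpace ℂ H₂] [CompleteSpace H₂]
    (U : H₁ →L[ℂ] H₂) : Prop :=
  ContinuousLinearMap.adjoint U ∘L U = ContinuousLinearMap.id ℂ H₁ ∧
    U ∘L ContinuousLinearMap.adjoint U = ContinuousLinearMap.id ℂ H₂

/-- A central unitary of the C*-algebra of approximable operators on a coarse module. -/
def IsCentralUnitary {X : Type} {H : Type} [NormedAddCommGroup H] [InnerProductSpace ℂ H]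
    [CompleteSpace H] (𝒳 : LFCMSpace X) (M : CoarseModule 𝒳 H) (u : H →L[ℂ] H) : Prop :=
  Approximable 𝒳 M.proj M.proj u ∧ IsUnitaryOp u ∧
    ∀ t : H →L[ℂ] H, Approximable 𝒳 M.proj M.proj t → u ∘L t = t ∘L u

/-- Equivalence of operators modulo central unitaries. -/
def CongruentModCentral {X : Type} [NormedAddCommGroup H₁] [InnerProductSpace ℂ H₁]
    [CompleteSpace H₁] [NormedAddCommGroup H₂] [InnerProductSpace ℂ H₂] [CompleteSpace H₂]
    (𝒳 : LFCMSpace X) (C : CoarseModule 𝒳 H₁) (D : CoarseModule 𝒳 H₂)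
    (t s : H₁ →L[ℂ] H₂) : Prop :=
  ∃ u v, IsCentralUnitary 𝒳 C u ∧ IsCentralUnitary 𝒳 D v ∧ t = v ∘L s ∘L u

/-! ## Direct sums of modules -/

/-- The direct sum `T ⊕ S` of two operators, on the `ℓ²`-product of Hilbert spaces. -/
def prodOp [NormedAddCommGroup H₀] [InnerProductSpace ℂ H₀]
    [NormedAddCommGroup H₁] [InnerProductSpace ℂ H₁]
    [NormedAddCommGroup H₂] [InnerProductSpace ℂ H₂]
    [NormedAddCommGroup H₃] [InnerProductSpace ℂ H₃]
    (T : H₀ →L[ℂ] H₂) (S : H₁ →L[ℂ] H₃) :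
    WithLp 2 (H₀ × H₁) →L[ℂ] WithLp 2 (H₂ × H₃) :=
  (WithLp.prodContinuousLinearEquiv 2 ℂ H₂ H₃).symm.toContinuousLinearMap ∘L
    (T.prodMap S) ∘L (WithLp.prodContinuousLinearEquiv 2 ℂ H₀ H₁).toContinuousLinearMap

/-- The canonical inclusion `H₀ → H₀ ⊕ H₁`. -/
def inlOp (H₀ H₁ : Type) [NormedAddCommGroup H₀] [InnerProductSpace ℂ H₀]
    [NormedAddCommGroup H₁] [InnerProductSpace ℂ H₁] :
    H₀ →L[ℂ] WithLp 2 (H₀ × H₁) :=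
  (WithLp.prodContinuousLinearEquiv 2 ℂ H₀ H₁).symm.toContinuousLinearMap ∘L
    ContinuousLinearMap.inl ℂ H₀ H₁

/-- The canonical inclusion `H₁ → H₀ ⊕ H₁`. -/
def inrOp (H₀ H₁ : Type) [NormedAddCommGroup H₀] [InnerProductSpace ℂ H₀]
    [NormedAddCommGroup H₁] [InnerProductSpace ℂ H₁] :
    H₁ →L[ℂ] WithLp 2 (H₀ × H₁) :=
  (WithLp.prodContinuousLinearEquiv 2 ℂ H₀ H₁).symm.toContinuousLinearMap ∘L
    ContinuousLinearMap.inr ℂ H₀ H₁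

/-- The canonical projection `H₀ ⊕ H₁ → H₀`. -/
def fstOp (H₀ H₁ : Type) [NormedAddCommGroup H₀] [InnerProductSpace ℂ H₀]
    [NormedAddCommGroup H₁] [InnerProductSpace ℂ H₁] :
    WithLp 2 (H₀ × H₁) →L[ℂ] H₀ :=
  ContinuousLinearMap.fst ℂ H₀ H₁ ∘L
    (WithLp.prodContinuousLinearEquiv 2 ℂ H₀ H₁).toContinuousLinearMap

/-- The canonical projection `H₀ ⊕ H₁ → H₁`. -/
def sndOp (H₀ H₁ : Type) [NormedAddCommGroup H₀] [InnerProductSpace ℂ H₀]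
    [NormedAddCommGroup H₁] [InnerProductSpace ℂ H₁] :
    WithLp 2 (H₀ × H₁) →L[ℂ] H₁ :=
  ContinuousLinearMap.snd ℂ H₀ H₁ ∘L
    (WithLp.prodContinuousLinearEquiv 2 ℂ H₀ H₁).toContinuousLinearMap

/-- `M` is the direct sum of the coarse modules `C₀` and `C₁`. -/
def IsDirectSum {X : Type} [NormedAddCommGroup H₀] [InnerProductSpace ℂ H₀] [CompleteSpace H₀]
    [NormedAddCommGroup H₁] [InnerProductSpace ℂ H₁] [CompleteSpace H₁]
    (𝒳 : LFCMSpace X) (C₀ : CoarseModule 𝒳 H₀) (C₁ : CoarseModule 𝒳 H₁)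
    (M : CoarseModule 𝒳 (WithLp 2 (H₀ × H₁))) : Prop :=
  ∀ A : Set X, M.proj A = prodOp (C₀.proj A) (C₁.proj A)

/-! ## Bundled modules and *-functors -/

/-- A coarse module over `𝒳` bundled together with its Hilbert space; the objects of the
approximable category `𝒜(𝒳)`. -/
structure BundledModule {X : Type} (𝒳 : LFCMSpace X) where
  H : Type
  [instNorm : NormedAddCommGroup H]
  [instInner : InnerProductSpace ℂ H]
  [instComplete : CompleteSpace H]
  mod : CoarseModule 𝒳 H

attribute [instance] BundledModule.instNorm BundledModule.instInner BundledModule.instComplete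

/-- A *-functor `𝒜(𝒳) → 𝒜(𝒴)` between approximable categories: a map on objects together
with a ℂ-linear, multiplicative, adjoint-preserving map on approximable operators. -/
structure StarFunctor {X Y : Type} (𝒳 : LFCMSpace X) (𝒴 : LFCMSpace Y) where
  obj : BundledModule 𝒳 → BundledModule 𝒴
  map : ∀ {C D : BundledModule 𝒳} (t : C.H →L[ℂ] D.H),
      Approximable 𝒳 C.mod.proj D.mod.proj t → ((obj C).H →L[ℂ] (obj D).H)
  map_approximable : ∀ {C D : BundledModule 𝒳} (t : C.H →L[ℂ] D.H)
      (ht : Approximable 𝒳 C.mod.proj D.mod.proj t),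
      Approximable 𝒴 (obj C).mod.proj (obj D).mod.proj (map t ht)
  map_id : ∀ (C : BundledModule 𝒳)
      (h : Approximable 𝒳 C.mod.proj C.mod.proj (ContinuousLinearMap.id ℂ C.H)),
      map (ContinuousLinearMap.id ℂ C.H) h = ContinuousLinearMap.id ℂ (obj C).H
  map_comp : ∀ {C D G : BundledModule 𝒳} (t : C.H →L[ℂ] D.H) (s : D.H →L[ℂ] G.H)
      (ht : Approximable 𝒳 C.mod.proj D.mod.proj t)
      (hs : Approximable 𝒳 D.mod.proj G.mod.proj s)
      (hst : Approximable 𝒳 C.mod.proj G.mod.proj (s ∘L t)),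
      map (s ∘L t) hst = map s hs ∘L map t ht
  map_add : ∀ {C D : BundledModule 𝒳} (t s : C.H →L[ℂ] D.H)
      (ht : Approximable 𝒳 C.mod.proj D.mod.proj t)
      (hs : Approximable 𝒳 C.mod.proj D.mod.proj s)
      (hts : Approximable 𝒳 C.mod.proj D.mod.proj (t + s)),
      map (t + s) hts = map t ht + map s hs
  map_smul : ∀ {C D : BundledModule 𝒳} (c : ℂ) (t : C.H →L[ℂ] D.H)
      (ht : Approximable 𝒳 C.mod.proj D.mod.proj t)
      (hct : Approximable 𝒳 C.mod.proj D.mod.proj (c • t)),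
      map (c • t) hct = c • map t ht
  map_star : ∀ {C D : BundledModule 𝒳} (t : C.H →L[ℂ] D.H)
      (ht : Approximable 𝒳 C.mod.proj D.mod.proj t)
      (hstar : Approximable 𝒳 D.mod.proj C.mod.proj (ContinuousLinearMap.adjoint t)),
      map (ContinuousLinearMap.adjoint t) hstar = ContinuousLinearMap.adjoint (map t ht)

namespace StarFunctor

variable {𝒳 : LFCMSpace X} {𝒴 : LFCMSpace Y}

/-- A full functor. -/
def Full (F : StarFunctor 𝒳 𝒴) : Prop :=
  ∀ (C D : BundledModule 𝒳) (s : (F.obj C).H →L[ℂ] (F.obj D).H),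
    Approximable 𝒴 (F.obj C).mod.proj (F.obj D).mod.proj s →
    ∃ (t : C.H →L[ℂ] D.H) (ht : Approximable 𝒳 C.mod.proj D.mod.proj t), F.map t ht = s

/-- A faithful functor. -/
def Faithful (F : StarFunctor 𝒳 𝒴) : Prop :=
  ∀ (C D : BundledModule 𝒳) (t t' : C.H →L[ℂ] D.H)
    (ht : Approximable 𝒳 C.mod.proj D.mod.proj t)
    (ht' : Approximable 𝒳 C.mod.proj D.mod.proj t'),
    F.map t ht = F.map t' ht' → t = t'

/-- An essentially surjective functor (up to isomorphism in the approximable category). -/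
def EssSurj (F : StarFunctor 𝒳 𝒴) : Prop :=
  ∀ D' : BundledModule 𝒴, ∃ C : BundledModule 𝒳,
    ∃ u : (F.obj C).H →L[ℂ] D'.H, Approximable 𝒴 (F.obj C).mod.proj D'.mod.proj u ∧
    ∃ v : D'.H →L[ℂ] (F.obj C).H, Approximable 𝒴 D'.mod.proj (F.obj C).mod.proj v ∧
      v ∘L u = ContinuousLinearMap.id ℂ (F.obj C).H ∧
      u ∘L v = ContinuousLinearMap.id ℂ D'.H

/-- A unitary `U` implements the *-isomorphism induced by `F` on the endomorphism algebra of
a module `C`. -/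
def Implements (F : StarFunctor 𝒳 𝒴) (C : BundledModule 𝒳)
    (U : C.H →L[ℂ] (F.obj C).H) : Prop :=
  IsUnitaryOp U ∧ ∀ (t : C.H →L[ℂ] C.H) (ht : Approximable 𝒳 C.mod.proj C.mod.proj t),
    F.map t ht = U ∘L t ∘L ContinuousLinearMap.adjoint U

end StarFunctor

/-- The graph of a map, as a relation `⊆ Y × X`. -/
def mapGraph {X Y : Type} (f : X → Y) : Set (Y × X) := {p | p.1 = f p.2}

/-- A relation `R ⊆ Y × X` is a coarse equivalence from `DX ⊆ X` to `DY ⊆ Y` (each with the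
subspace coarse structure): controlled in both directions, densely defined and coarsely
surjective relative to `DX` and `DY`. -/
def IsRelCoarseEquivOn {X Y : Type} (CX : CoarseSpace X) (CY : CoarseSpace Y)
    (DX : Set X) (DY : Set Y) (R : Set (Y × X)) : Prop :=
  (∀ E ∈ CX.entourages, RelComp R (RelComp E (RelTrans R)) ∈ CY.entourages) ∧
  (∀ F ∈ CY.entourages, RelComp (RelTrans R) (RelComp F R) ∈ CX.entourages) ∧
  CX.Asymptotic (Prod.snd '' R) DX ∧ CY.Asymptotic (Prod.fst '' R) DY

/-- `S ⊆ X × Y` is a coarse inverse of the relation `R ⊆ Y × X` between `DX` and `DY`: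
both compositions are asymptotic to the respective (restricted) diagonals. -/
def IsRelCoarseInverseOn {X Y : Type} (CX : CoarseSpace X) (CY : CoarseSpace Y)
    (DX : Set X) (DY : Set Y) (R : Set (Y × X)) (S : Set (X × Y)) : Prop :=
  RelAsymp CX CX (RelComp S R) {p : X × X | p.1 = p.2 ∧ p.1 ∈ DX} ∧
  RelAsymp CY CY (RelComp R S) {p : Y × Y | p.1 = p.2 ∧ p.1 ∈ DY}

/-- The statement that a coarse map `f` represents the coarse embedding induced by a full and
faithful *-functor `F` via approximate relations of implementing unitaries. -/
def RepresentsInducedEmbedding {X Y : Type} {𝒳 : LFCMSpace X} {𝒴 : LFCMSpace Y}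
    (F : StarFunctor 𝒳 𝒴) (f : X → Y) : Prop :=
  ∀ (C : BundledModule 𝒳), IsFaithfulMod 𝒳 C.mod →
  ∀ (U : C.H →L[ℂ] (F.obj C).H), F.Implements C U →
  ∀ δ : ℝ, 0 < δ → δ < 1 →
  ∃ F₀ ∈ 𝒴.coarse.entourages, ∃ E₀ ∈ 𝒳.coarse.entourages,
    ∀ F' ∈ 𝒴.coarse.entourages, F₀ ⊆ F' → ∀ E ∈ 𝒳.coarse.entourages, E₀ ⊆ E →
      RelAsymp 𝒳.coarse 𝒴.coarse
        (approxRel 𝒳 𝒴 C.mod.proj (F.obj C).mod.proj U δ F' E) (mapGraph f)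

/-- Bundle a coarse module into an object of the approximable category. -/
abbrev BundledModule.ofModule {X : Type} {𝒳 : LFCMSpace X} {H : Type} [NormedAddCommGroup H]
    [InnerProductSpace ℂ H] [CompleteSpace H] (M : CoarseModule 𝒳 H) : BundledModule 𝒳 :=
  ⟨H, M⟩

theorem LFCMSpace.disc_mem {X : Type} (𝒳 : LFCMSpace X) :
    𝒳.disc ∈ 𝒳.coarse.entourages := by
  obtain ⟨E, hE, hEP⟩ := 𝒳.isPartition.controlled
  refine 𝒳.coarse.mem_of_subset hE.1 ?_
  intro p hp
  simp only [LFCMSpace.disc, Set.mem_iUnion] at hp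
  obtain ⟨A, hA, hpA⟩ := hp
  exact hEP A hA hpA

theorem prodOp_comp_inlOp {H₀ H₁ H₂ H₃ : Type}
    [NormedAddCommGroup H₀] [InnerProductSpace ℂ H₀]
    [NormedAddCommGroup H₁] [InnerProductSpace ℂ H₁]
    [NormedAddCommGroup H₂] [InnerProductSpace ℂ H₂]
    [NormedAddCommGroup H₃] [InnerProductSpace ℂ H₃]
    (T : H₀ →L[ℂ] H₂) (S : H₁ →L[ℂ] H₃) :
    prodOp T S ∘L inlOp H₀ H₁ = inlOp H₂ H₃ ∘L T := by
  ext x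
  simp [prodOp, inlOp]

theorem prodOp_comp_inrOp {H₀ H₁ H₂ H₃ : Type}
    [NormedAddCommGroup H₀] [InnerProductSpace ℂ H₀]
    [NormedAddCommGroup H₁] [InnerProductSpace ℂ H₁]
    [NormedAddCommGroup H₂] [InnerProductSpace ℂ H₂]
    [NormedAddCommGroup H₃] [InnerProductSpace ℂ H₃]
    (T : H₀ →L[ℂ] H₂) (S : H₁ →L[ℂ] H₃) :
    prodOp T S ∘L inrOp H₀ H₁ = inrOp H₂ H₃ ∘L S := by
  ext x
  simp [prodOp, inrOp]

/-- The canonical inclusion into a direct sum of coarse modules is approximable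
(indeed it has controlled propagation). -/
theorem IsDirectSum.approximable_inl {X : Type} {H₀ H₁ : Type}
    [NormedAddCommGroup H₀] [InnerProductSpace ℂ H₀] [CompleteSpace H₀]
    [NormedAddCommGroup H₁] [InnerProductSpace ℂ H₁] [CompleteSpace H₁]
    {𝒳 : LFCMSpace X} {C₀ : CoarseModule 𝒳 H₀} {C₁ : CoarseModule 𝒳 H₁}
    {M : CoarseModule 𝒳 (WithLp 2 (H₀ × H₁))} (hM : IsDirectSum 𝒳 C₀ C₁ M) :
    Approximable 𝒳 C₀.proj M.proj (inlOp H₀ H₁) := by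
  intro ε hε
  refine ⟨inlOp H₀ H₁, ?_, by simp [hε.le]⟩
  refine 𝒳.coarse.mem_of_subset (𝒳.coarse.comp_mem 𝒳.disc_mem 𝒳.disc_mem) ?_
  rintro ⟨y, x⟩ hyx
  obtain ⟨s, ⟨B, A, rfl, hBmeas, hBb, hAmeas, hAb, hne⟩, hmem⟩ := hyx
  have key : M.proj B ∘L inlOp H₀ H₁ ∘L C₀.proj A
      = inlOp H₀ H₁ ∘L C₀.proj (B ∩ A) := by
    rw [C₀.proj_inter hBmeas hAmeas, hM B, ← ContinuousLinearMap.comp_assoc,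
      prodOp_comp_inlOp, ContinuousLinearMap.comp_assoc]
  have hBA : (B ∩ A).Nonempty := by
    by_contra h
    rw [Set.not_nonempty_iff_eq_empty] at h
    apply hne
    rw [key, h, C₀.proj_empty]
    ext z
    simp
  obtain ⟨z, hzB, hzA⟩ := hBA
  obtain ⟨hyB, hxA⟩ := hmem
  exact ⟨z, hBb ⟨hyB, hzB⟩, hAb ⟨hzA, hxA⟩⟩

theorem IsDirectSum.approximable_inr {X : Type} {H₀ H₁ : Type}
    [NormedAddCommGroup H₀] [InnerProductSpace ℂ H₀] [CompleteSpace H₀]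
    [NormedAddCommGroup H₁] [InnerProductSpace ℂ H₁] [CompleteSpace H₁]
    {𝒳 : LFCMSpace X} {C₀ : CoarseModule 𝒳 H₀} {C₁ : CoarseModule 𝒳 H₁}
    {M : CoarseModule 𝒳 (WithLp 2 (H₀ × H₁))} (hM : IsDirectSum 𝒳 C₀ C₁ M) :
    Approximable 𝒳 C₁.proj M.proj (inrOp H₀ H₁) := by
  intro ε hε
  refine ⟨inrOp H₀ H₁, ?_, by simp [hε.le]⟩
  refine 𝒳.coarse.mem_of_subset (𝒳.coarse.comp_mem 𝒳.disc_mem 𝒳.disc_mem) ?_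
  rintro ⟨y, x⟩ hyx
  obtain ⟨s, ⟨B, A, rfl, hBmeas, hBb, hAmeas, hAb, hne⟩, hmem⟩ := hyx
  have key : M.proj B ∘L inrOp H₀ H₁ ∘L C₁.proj A
      = inrOp H₀ H₁ ∘L C₁.proj (B ∩ A) := by
    rw [C₁.proj_inter hBmeas hAmeas, hM B, ← ContinuousLinearMap.comp_assoc,
      prodOp_comp_inrOp, ContinuousLinearMap.comp_assoc]
  have hBA : (B ∩ A).Nonempty := by
    by_contra h
    rw [Set.not_nonempty_iff_eq_empty] at h
    apply hne
    rw [key, h, C₁.proj_empty]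
    ext z
    simp
  obtain ⟨z, hzB, hzA⟩ := hBA
  obtain ⟨hyB, hxA⟩ := hmem
  exact ⟨z, hBb ⟨hyB, hzB⟩, hAb ⟨hzA, hxA⟩⟩

/-! ## Coarse spaces and LFCM spaces -/

/-- A countably generated coarse structure has a cofinal increasing sequence of entourages. -/
theorem CoarseSpace.exists_cofinal_seq {X : Type} {C : CoarseSpace X}
    (h : C.IsCountablyGenerated) :
    ∃ F : ℕ → Set (X × X), Monotone F ∧ (∀ n, F n ∈ C.entourages) ∧
      ∀ E ∈ C.entourages, ∃ n, E ⊆ F n := by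
  obtain ⟨G, hGc, hGsub, hGmin⟩ := h
  obtain ⟨g, hg⟩ := (hGc.insert {p : X × X | p.1 = p.2}).exists_eq_range (Set.insert_nonempty _ _)
  have hgmem : ∀ n, g n ∈ C.entourages := by
    intro n
    have : g n ∈ insert {p : X × X | p.1 = p.2} G := hg ▸ Set.mem_range_self n
    rcases this with h | h
    · rw [h]; exact C.diagonal_mem
    · exact hGsub h
  let F : ℕ → Set (X × X) := fun n => Nat.rec {p : X × X | p.1 = p.2}
    (fun n E => ((E ∪ RelTrans E) ∪ RelComp E E) ∪ g n) n
  have hFs : ∀ n, F (n + 1) = ((F n ∪ RelTrans (F n)) ∪ RelComp (F n) (F n)) ∪ g n :=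
    fun n => rfl
  have hmono : Monotone F := monotone_nat_of_le_succ fun n => by
    rw [hFs]
    exact fun p hp => Or.inl (Or.inl (Or.inl hp))
  have hF : ∀ n, F n ∈ C.entourages := by
    intro n
    induction n with
    | zero => exact C.diagonal_mem
    | succ n ih =>
      rw [hFs]
      exact C.union_mem (C.union_mem (C.union_mem ih (C.transpose_mem ih)) (C.comp_mem ih ih))
        (hgmem n)
  refine ⟨F, hmono, hF, ?_⟩
  let C' : CoarseSpace X :=
    { entourages := {E | ∃ n, E ⊆ F n}
      diagonal_mem := ⟨0, subset_rfl⟩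
      mem_of_subset := fun ⟨n, hn⟩ h => ⟨n, h.trans hn⟩
      union_mem := fun ⟨n, hn⟩ ⟨m, hm⟩ => ⟨max n m, Set.union_subset
        (hn.trans (hmono (le_max_left _ _))) (hm.trans (hmono (le_max_right _ _)))⟩
      transpose_mem := fun {E} ⟨n, hn⟩ => ⟨n + 1, fun p hp => by
        rw [hFs]
        exact Or.inl (Or.inl (Or.inr (hn hp)))⟩
      comp_mem := fun {E E'} ⟨n, hn⟩ ⟨m, hm⟩ => ⟨max n m + 1, fun p hp => by
        rw [hFs]
        obtain ⟨y, h1, h2⟩ := hp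
        exact Or.inl (Or.inr ⟨y, hmono (le_max_left _ _) (hn h1),
          hmono (le_max_right _ _) (hm h2)⟩)⟩ }
  intro E hE
  refine hGmin C' ?_ hE
  intro A hA
  have : A ∈ Set.range g := hg ▸ Set.mem_insert_of_mem _ hA
  obtain ⟨n, rfl⟩ := this
  exact ⟨n + 1, fun p hp => by rw [hFs]; exact Or.inr hp⟩

/-- Finitely many entourages are contained in a common one. -/
theorem CoarseSpace.exists_finite_bound {X : Type} (C : CoarseSpace X) {ι : Type*} {s : Set ι}
    (hs : s.Finite) (E : ι → Set (X × X)) (hE : ∀ i ∈ s, E i ∈ C.entourages) :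
    ∃ F ∈ C.entourages, ∀ i ∈ s, E i ⊆ F := by
  induction s, hs using Set.Finite.induction_on with
  | empty => exact ⟨_, C.diagonal_mem, by simp⟩
  | @insert a s _ _ ih =>
    obtain ⟨F, hF, h⟩ := ih fun i hi => hE i (Set.mem_insert_of_mem _ hi)
    refine ⟨E a ∪ F, C.union_mem (hE a (Set.mem_insert _ _)) hF, ?_⟩
    rintro i (rfl | hi)
    · exact Set.subset_union_left
    · exact (h i hi).trans Set.subset_union_right

namespace LFCMSpace

variable (𝒳 : LFCMSpace X)

theorem univ_mem : Set.univ ∈ 𝒳.meas := by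
  simpa using 𝒳.compl_mem 𝒳.empty_mem

theorem exists_block (x : X) : ∃ Q ∈ 𝒳.partition, x ∈ Q := by
  have : x ∈ ⋃₀ 𝒳.partition := by rw [𝒳.isPartition.covers]; trivial
  exact this

variable {𝒳}

theorem block_eq {Q Q' : Set X} (hQ : Q ∈ 𝒳.partition) (hQ' : Q' ∈ 𝒳.partition) {x : X}
    (hx : x ∈ Q) (hx' : x ∈ Q') : Q = Q' := by
  by_contra h
  exact Set.disjoint_left.1 (𝒳.isPartition.pairwiseDisjoint Q hQ Q' hQ' h) hx hx'

theorem mem_disc {x y : X} : (x, y) ∈ 𝒳.disc ↔ ∃ Q ∈ 𝒳.partition, x ∈ Q ∧ y ∈ Q := by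
  simp only [disc, Set.mem_iUnion, Set.mem_prod, exists_prop]

theorem disc_refl (x : X) : (x, x) ∈ 𝒳.disc := by
  obtain ⟨Q, hQ, hx⟩ := 𝒳.exists_block x
  exact mem_disc.2 ⟨Q, hQ, hx, hx⟩

theorem mem_block_of_disc {x y : X} {Q : Set X} (hQ : Q ∈ 𝒳.partition) (hx : x ∈ Q)
    (h : (x, y) ∈ 𝒳.disc) : y ∈ Q := by
  obtain ⟨Q', hQ', hx', hy'⟩ := mem_disc.1 h
  rwa [block_eq hQ hQ' hx hx']

theorem block_prod_subset {Q : Set X} (hQ : Q ∈ 𝒳.partition) : Q ×ˢ Q ⊆ 𝒳.disc :=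
  fun _ hp => mem_disc.2 ⟨Q, hQ, hp.1, hp.2⟩

theorem sUnion_mem {S : Set (Set X)} (hS : S ⊆ 𝒳.partition) : ⋃₀ S ∈ 𝒳.meas := by
  rw [𝒳.isPartition.meas_iff]
  intro Q hQ
  by_cases h : Q ∈ S
  · rw [Set.inter_eq_right.2 (Set.subset_sUnion_of_mem h)]
    exact 𝒳.isPartition.measurable hQ
  · convert 𝒳.empty_mem
    rw [Set.eq_empty_iff_forall_notMem]
    rintro x ⟨⟨Q', hQ', hx'⟩, hx⟩
    exact h (block_eq hQ (hS hQ') hx hx' ▸ hQ')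

/-- The measurable `F`-neighbourhood of a set: the union of all blocks meeting `F[B]`. -/
def fatten (𝒳 : LFCMSpace X) (F : Set (X × X)) (B : Set X) : Set X :=
  ⋃₀ {Q | Q ∈ 𝒳.partition ∧ ∃ x ∈ Q, ∃ b ∈ B, (x, b) ∈ F}

theorem fatten_mem (F : Set (X × X)) (B : Set X) : 𝒳.fatten F B ∈ 𝒳.meas :=
  sUnion_mem fun _ h => h.1

theorem mem_fatten {F : Set (X × X)} {B : Set X} {x : X} :
    x ∈ 𝒳.fatten F B ↔ ∃ y, (x, y) ∈ 𝒳.disc ∧ ∃ b ∈ B, (y, b) ∈ F := by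
  constructor
  · rintro ⟨Q, ⟨hQ, y, hy, b, hb, hyb⟩, hx⟩
    exact ⟨y, mem_disc.2 ⟨Q, hQ, hx, hy⟩, b, hb, hyb⟩
  · rintro ⟨y, hxy, b, hb, hyb⟩
    obtain ⟨Q, hQ, hx, hy⟩ := mem_disc.1 hxy
    exact ⟨Q, ⟨hQ, y, hy, b, hb, hyb⟩, hx⟩

end LFCMSpace

/-! ## Modules -/

namespace CoarseModule

variable {𝒳 : LFCMSpace X} {H : Type} [NormedAddCommGroup H] [InnerProductSpace ℂ H]
  [CompleteSpace H] (M : CoarseModule 𝒳 H)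

theorem proj_proj {A B : Set X} (hA : A ∈ 𝒳.meas) (hB : B ∈ 𝒳.meas) (x : H) :
    M.proj A (M.proj B x) = M.proj (A ∩ B) x := by
  rw [M.proj_inter hA hB]; rfl

theorem proj_idem {A : Set X} (hA : A ∈ 𝒳.meas) (x : H) :
    M.proj A (M.proj A x) = M.proj A x := by
  rw [M.proj_proj hA hA, Set.inter_self]

theorem proj_of_disjoint {A B : Set X} (hA : A ∈ 𝒳.meas) (hB : B ∈ 𝒳.meas)
    (h : Disjoint A B) (x : H) : M.proj A (M.proj B x) = 0 := by
  rw [M.proj_proj hA hB, Set.disjoint_iff_inter_eq_empty.1 h, M.proj_empty]; rfl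

theorem proj_of_subset {A B : Set X} (hA : A ∈ 𝒳.meas) (hB : B ∈ 𝒳.meas)
    (h : A ⊆ B) (x : H) : M.proj B (M.proj A x) = M.proj A x := by
  rw [M.proj_proj hB hA, Set.inter_eq_right.2 h]

theorem proj_of_subset' {A B : Set X} (hA : A ∈ 𝒳.meas) (hB : B ∈ 𝒳.meas)
    (h : A ⊆ B) (x : H) : M.proj A (M.proj B x) = M.proj A x := by
  rw [M.proj_proj hA hB, Set.inter_eq_left.2 h]

theorem inner_proj {A : Set X} (hA : A ∈ 𝒳.meas) (x y : H) :
    inner ℂ (M.proj A x) y = inner ℂ x (M.proj A y) := by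
  conv_lhs => rw [← (ContinuousLinearMap.isSelfAdjoint_iff'.1 (M.proj_selfAdjoint A hA))]
  rw [ContinuousLinearMap.adjoint_inner_left]

theorem proj_univ (x : H) : M.proj Set.univ x = x := by
  have h : ∀ x, M.proj Set.univ x = ContinuousLinearMap.id ℂ H x := by
    intro x
    refine congrFun (Continuous.ext_on M.nondeg (M.proj Set.univ).continuous
      (ContinuousLinearMap.id ℂ H).continuous ?_) x
    intro z hz
    refine Submodule.span_induction (p := fun z _ => M.proj Set.univ z = z) ?_ ?_ ?_ ?_ hz
    · intro z hz
      simp only [Set.mem_iUnion] at hz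
      obtain ⟨A, ⟨hA, -⟩, w, rfl⟩ := hz
      exact M.proj_of_subset hA 𝒳.univ_mem (Set.subset_univ _) w
    · simp
    · intro a b _ _ ha hb
      rw [map_add, ha, hb]
    · intro c a _ ha
      rw [map_smul, ha]
  exact h x

theorem proj_add_compl {A : Set X} (hA : A ∈ 𝒳.meas) (x : H) :
    M.proj A x + M.proj Aᶜ x = x := by
  have := M.proj_union hA (𝒳.compl_mem hA) disjoint_compl_right
  rw [Set.union_compl_self] at this
  conv_rhs => rw [← M.proj_univ x, this]
  rfl

theorem norm_sq_proj_add {A : Set X} (hA : A ∈ 𝒳.meas) (x : H) :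
    ‖M.proj A x‖ ^ 2 + ‖M.proj Aᶜ x‖ ^ 2 = ‖x‖ ^ 2 := by
  conv_rhs => rw [← M.proj_add_compl hA x]
  have h0 : inner ℂ (M.proj A x) (M.proj Aᶜ x) = 0 := by
    rw [M.inner_proj hA, M.proj_of_disjoint hA (𝒳.compl_mem hA) disjoint_compl_right,
      inner_zero_right]
  have := norm_add_sq_eq_norm_sq_add_norm_sq_of_inner_eq_zero (𝕜 := ℂ) _ _ h0
  nlinarith

theorem norm_proj_le {A : Set X} (hA : A ∈ 𝒳.meas) (x : H) : ‖M.proj A x‖ ≤ ‖x‖ := by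
  have := M.norm_sq_proj_add hA x
  exact abs_le_of_sq_le_sq' (by nlinarith [sq_nonneg ‖M.proj Aᶜ x‖]) (norm_nonneg _) |>.2

/-- Every vector is approximated by its components in finitely many blocks. -/
theorem exists_finite_approx (z : H) {ε : ℝ} (hε : 0 < ε) :
    ∃ S : Set (Set X), S.Finite ∧ S ⊆ 𝒳.partition ∧ ‖z - M.proj (⋃₀ S) z‖ < ε := by
  have key : ∀ z' ∈ Submodule.span ℂ
      (⋃ A ∈ {A | A ∈ 𝒳.meas ∧ 𝒳.coarse.IsBounded A}, Set.range (M.proj A)),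
      ∃ S : Set (Set X), S.Finite ∧ S ⊆ 𝒳.partition ∧ M.proj (⋃₀ S) z' = z' := by
    intro z' hz'
    have hmono : ∀ S S' : Set (Set X), S ⊆ 𝒳.partition → S' ⊆ 𝒳.partition → S ⊆ S' → ∀ a,
        M.proj (⋃₀ S) a = a → M.proj (⋃₀ S') a = a := by
      intro S S' hS hS' hSS a ha
      rw [← ha]
      exact M.proj_of_subset (LFCMSpace.sUnion_mem hS) (LFCMSpace.sUnion_mem hS')
        (Set.sUnion_subset_sUnion hSS) _
    induction hz' using Submodule.span_induction with
    | mem z hz =>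
      simp only [Set.mem_iUnion] at hz
      obtain ⟨A, ⟨hA, hAb⟩, w, rfl⟩ := hz
      refine ⟨_, 𝒳.isPartition.locallyFinite A hAb, fun _ h => h.1, ?_⟩
      refine M.proj_of_subset hA (LFCMSpace.sUnion_mem fun _ h => h.1) ?_ w
      intro x hx
      obtain ⟨Q, hQ, hxQ⟩ := 𝒳.exists_block x
      exact ⟨Q, ⟨hQ, x, hxQ, hx⟩, hxQ⟩
    | zero => exact ⟨∅, Set.finite_empty, Set.empty_subset _, by simp⟩
    | add a b _ _ ha hb =>
      obtain ⟨S, hSf, hS, ha⟩ := ha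
      obtain ⟨S', hSf', hS', hb⟩ := hb
      refine ⟨S ∪ S', hSf.union hSf', Set.union_subset hS hS', ?_⟩
      rw [map_add, hmono S _ hS (Set.union_subset hS hS') Set.subset_union_left a ha,
        hmono S' _ hS' (Set.union_subset hS hS') Set.subset_union_right b hb]
    | smul c a _ ha =>
      obtain ⟨S, hSf, hS, ha⟩ := ha
      exact ⟨S, hSf, hS, by rw [map_smul, ha]⟩
  obtain ⟨z', hz', hzz⟩ := Metric.dense_iff.1 M.nondeg z ε hε
  obtain ⟨S, hSf, hS, hSz⟩ := key z' hzz
  refine ⟨S, hSf, hS, ?_⟩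
  have hm := LFCMSpace.sUnion_mem hS
  have h1 : z - M.proj (⋃₀ S) z = M.proj (⋃₀ S)ᶜ (z - z') := by
    have h2 : M.proj (⋃₀ S)ᶜ z' = 0 := by
      rw [← hSz, M.proj_of_disjoint (𝒳.compl_mem hm) hm disjoint_compl_left]
    rw [map_sub, h2, sub_zero, sub_eq_iff_eq_add, add_comm, M.proj_add_compl hm]
  rw [h1]
  refine (M.norm_proj_le (𝒳.compl_mem hm) _).trans_lt ?_
  rwa [← dist_eq_norm, dist_comm]

/-- An operator killing all block components of a vector kills the vector. -/
theorem eq_zero_of_blocks {G : Type*} [NormedAddCommGroup G] [NormedSpace ℂ G] (R : H →L[ℂ] G)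
    (w : H) (h : ∀ Q ∈ 𝒳.partition, R (M.proj Q w) = 0) : R w = 0 := by
  have hfin : ∀ S : Set (Set X), S.Finite → S ⊆ 𝒳.partition → R (M.proj (⋃₀ S) w) = 0 := by
    intro S hS
    induction S, hS using Set.Finite.induction_on with
    | empty => intro _; simp [M.proj_empty]
    | @insert Q S hQS _ ih =>
      intro hsub
      have hQ : Q ∈ 𝒳.partition := hsub (Set.mem_insert _ _)
      have hS : S ⊆ 𝒳.partition := (Set.subset_insert _ _).trans hsub
      have hdisj : Disjoint Q (⋃₀ S) := by
        rw [Set.disjoint_sUnion_right]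
        intro Q' hQ'
        refine 𝒳.isPartition.pairwiseDisjoint Q hQ Q' (hS hQ') ?_
        rintro rfl
        exact hQS hQ'
      rw [Set.sUnion_insert, M.proj_union (𝒳.isPartition.measurable hQ)
        (LFCMSpace.sUnion_mem hS) hdisj, add_apply, map_add, h Q hQ, ih hS,
        add_zero]
  rw [← norm_le_zero_iff]
  refine le_of_forall_pos_le_add fun ε hε => ?_
  obtain ⟨S, hSf, hS, hz⟩ := M.exists_finite_approx w (ε := ε / (‖R‖ + 1)) (by positivity)
  have : R w = R (w - M.proj (⋃₀ S) w) := by rw [map_sub, hfin S hSf hS, sub_zero]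
  rw [this, zero_add]
  calc ‖R (w - M.proj (⋃₀ S) w)‖ ≤ ‖R‖ * (ε / (‖R‖ + 1)) := by
        refine (R.le_opNorm _).trans ?_
        gcongr
    _ ≤ (‖R‖ + 1) * (ε / (‖R‖ + 1)) := by gcongr; linarith
    _ = ε := by field_simp

theorem eq_zero_of_proj_blocks {w : H} (h : ∀ Q ∈ 𝒳.partition, M.proj Q w = 0) : w = 0 :=
  M.eq_zero_of_blocks (ContinuousLinearMap.id ℂ H) w h

end CoarseModule

/-! ## Operators supported near the diagonal -/

section Support

variable {𝒳 : LFCMSpace X}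
variable [NormedAddCommGroup H₁] [InnerProductSpace ℂ H₁] [CompleteSpace H₁]
variable [NormedAddCommGroup H₂] [InnerProductSpace ℂ H₂] [CompleteSpace H₂]
variable [NormedAddCommGroup H₃] [InnerProductSpace ℂ H₃] [CompleteSpace H₃]
variable {C : CoarseModule 𝒳 H₁} {D : CoarseModule 𝒳 H₂} {G : CoarseModule 𝒳 H₃}

/-- The matrix blocks of `t` outside of `E` vanish. -/
def BlockSupp (C : CoarseModule 𝒳 H₁) (D : CoarseModule 𝒳 H₂) (E : Set (X × X))
    (t : H₁ →L[ℂ] H₂) : Prop :=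
  ∀ Q' ∈ 𝒳.partition, ∀ Q ∈ 𝒳.partition, ∀ x, D.proj Q' (t (C.proj Q x)) ≠ 0 → Q' ×ˢ Q ⊆ E

theorem hasControlledPropagation_iff {t : H₁ →L[ℂ] H₂} :
    HasControlledPropagation 𝒳 C.proj D.proj t ↔
      ∃ E ∈ 𝒳.coarse.entourages, BlockSupp C D E t := by
  constructor
  · intro h
    refine ⟨_, h, fun Q' hQ' Q hQ x hx => ?_⟩
    refine Set.subset_sUnion_of_mem ⟨Q', Q, rfl, 𝒳.isPartition.measurable hQ',
      LFCMSpace.block_prod_subset hQ', 𝒳.isPartition.measurable hQ,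
      LFCMSpace.block_prod_subset hQ, fun h0 => hx ?_⟩
    exact congrArg (fun s : H₁ →L[ℂ] H₂ => s x) h0
  · rintro ⟨E, hE, h⟩
    refine 𝒳.coarse.mem_of_subset hE ?_
    rintro ⟨y, x⟩ ⟨-, ⟨B, A, rfl, hB, hBd, hA, hAd, hne⟩, hy, hx⟩
    obtain ⟨Q', hQ', hyQ⟩ := 𝒳.exists_block y
    obtain ⟨Q, hQ, hxQ⟩ := 𝒳.exists_block x
    have hBQ : B ⊆ Q' := fun z hz => LFCMSpace.mem_block_of_disc hQ' hyQ (hBd ⟨hy, hz⟩)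
    have hAQ : A ⊆ Q := fun z hz => LFCMSpace.mem_block_of_disc hQ hxQ (hAd ⟨hx, hz⟩)
    obtain ⟨v, hv⟩ : ∃ v, (D.proj B ∘L t ∘L C.proj A) v ≠ 0 := by
      by_contra! h0
      exact hne (ContinuousLinearMap.ext h0)
    refine h Q' hQ' Q hQ (C.proj A v) (fun h0 => hv ?_) ⟨hyQ, hxQ⟩
    have hQm := 𝒳.isPartition.measurable hQ
    have hQm' := 𝒳.isPartition.measurable hQ'
    rw [C.proj_of_subset hA hQm hAQ] at h0
    change D.proj B (t (C.proj A v)) = 0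
    rw [← D.proj_of_subset' hB hQm' hBQ, h0, map_zero]

theorem BlockSupp.mono {E E' : Set (X × X)} (hE : E ⊆ E') {t : H₁ →L[ℂ] H₂}
    (h : BlockSupp C D E t) : BlockSupp C D E' t :=
  fun Q' hQ' Q hQ x hx => (h Q' hQ' Q hQ x hx).trans hE

theorem BlockSupp.id (C : CoarseModule 𝒳 H₁) :
    BlockSupp C C 𝒳.disc (ContinuousLinearMap.id ℂ H₁) := by
  intro Q' hQ' Q hQ x hx
  have : Q' = Q := by
    by_contra hne
    exact hx (C.proj_of_disjoint (𝒳.isPartition.measurable hQ') (𝒳.isPartition.measurable hQ)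
      (𝒳.isPartition.pairwiseDisjoint Q' hQ' Q hQ hne) x)
  subst this
  exact LFCMSpace.block_prod_subset hQ'

theorem BlockSupp.comp {E E' : Set (X × X)} {s : H₂ →L[ℂ] H₃} {t : H₁ →L[ℂ] H₂}
    (hs : BlockSupp D G E s) (ht : BlockSupp C D E' t) :
    BlockSupp C G (RelComp E E') (s ∘L t) := by
  intro Q'' hQ'' Q hQ x hx
  have : ∃ Q' ∈ 𝒳.partition, (G.proj Q'' ∘L s) (D.proj Q' (t (C.proj Q x))) ≠ 0 := by
    by_contra! h0
    exact hx (D.eq_zero_of_blocks (G.proj Q'' ∘L s) _ h0)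
  obtain ⟨Q', hQ', h⟩ := this
  have h1 := hs Q'' hQ'' Q' hQ' _ h
  have h2 := ht Q' hQ' Q hQ x fun h0 => h (by rw [h0, map_zero])
  obtain ⟨q, hq⟩ := 𝒳.isPartition.nonempty Q' hQ'
  rintro ⟨a, b⟩ ⟨ha, hb⟩
  exact ⟨q, h1 ⟨ha, hq⟩, h2 ⟨hq, hb⟩⟩

theorem BlockSupp.adjoint {E : Set (X × X)} {t : H₁ →L[ℂ] H₂} (ht : BlockSupp C D E t) :
    BlockSupp D C (RelTrans E) (ContinuousLinearMap.adjoint t) := by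
  intro Q' hQ' Q hQ x hx
  have hQm := 𝒳.isPartition.measurable hQ
  have hQm' := 𝒳.isPartition.measurable hQ'
  set v := C.proj Q' (ContinuousLinearMap.adjoint t (D.proj Q x)) with hv
  have h1 : D.proj Q (t (C.proj Q' v)) ≠ 0 := by
    intro h0
    have h2 : inner ℂ v v = 0 := by
      nth_rewrite 1 [hv]
      rw [C.inner_proj hQm', ContinuousLinearMap.adjoint_inner_left, D.inner_proj hQm, h0,
        inner_zero_right]
    exact hx (inner_self_eq_zero.1 h2)
  rintro ⟨a, b⟩ ⟨ha, hb⟩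
  exact ht Q hQ Q' hQ' v h1 ⟨hb, ha⟩

theorem BlockSupp.add {E E' : Set (X × X)} {s t : H₁ →L[ℂ] H₂}
    (hs : BlockSupp C D E s) (ht : BlockSupp C D E' t) : BlockSupp C D (E ∪ E') (s + t) := by
  intro Q' hQ' Q hQ x hx
  by_cases h : D.proj Q' (s (C.proj Q x)) = 0
  · have h' : D.proj Q' (t (C.proj Q x)) ≠ 0 := fun h0 => hx (by
      rw [add_apply, map_add, h, h0, add_zero])
    exact (ht Q' hQ' Q hQ x h').trans Set.subset_union_right
  · exact (hs Q' hQ' Q hQ x h).trans Set.subset_union_left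

theorem BlockSupp.smul {E : Set (X × X)} {t : H₁ →L[ℂ] H₂} (c : ℂ)
    (ht : BlockSupp C D E t) : BlockSupp C D E (c • t) :=
  fun Q' hQ' Q hQ x hx => ht Q' hQ' Q hQ x fun h0 => hx (by
    rw [smul_apply, map_smul, h0, smul_zero])

theorem BlockSupp.proj_comp_proj {E : Set (X × X)} {t : H₁ →L[ℂ] H₂} (ht : BlockSupp C D E t)
    {B' B : Set X} (hB' : B' ∈ 𝒳.meas) (hB : B ∈ 𝒳.meas)
    (h : ∀ y ∈ B', ∀ x ∈ B, (y, x) ∉ E) (x : H₁) : D.proj B' (t (C.proj B x)) = 0 := by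
  refine C.eq_zero_of_blocks (D.proj B' ∘L t) (C.proj B x) fun Q hQ => ?_
  refine D.eq_zero_of_proj_blocks fun Q' hQ' => ?_
  have hQm := 𝒳.isPartition.measurable hQ
  have hQm' := 𝒳.isPartition.measurable hQ'
  by_contra hne
  have hc : D.proj Q' (t (C.proj Q (C.proj B x))) ≠ 0 := by
    intro h0
    apply hne
    change D.proj Q' (D.proj B' (t (C.proj Q (C.proj B x)))) = 0
    rw [D.proj_proj hQm' hB', Set.inter_comm, ← D.proj_proj hB' hQm', h0, map_zero]
  have hsub := ht Q' hQ' Q hQ _ hc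
  have h1 : (Q' ∩ B').Nonempty := by
    rw [Set.nonempty_iff_ne_empty]
    intro h0
    exact hne (D.proj_of_disjoint hQm' hB' (Set.disjoint_iff_inter_eq_empty.2 h0) _)
  have h2 : (Q ∩ B).Nonempty := by
    rw [Set.nonempty_iff_ne_empty]
    intro h0
    exact hc (by rw [C.proj_of_disjoint hQm hB (Set.disjoint_iff_inter_eq_empty.2 h0), map_zero,
      map_zero])
  obtain ⟨y, hy, hy'⟩ := h1
  obtain ⟨z, hz, hz'⟩ := h2
  exact h y hy' z hz' (hsub ⟨hy, hz⟩)

theorem approximable_of_blockSupp {E : Set (X × X)} (hE : E ∈ 𝒳.coarse.entourages)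
    {t : H₁ →L[ℂ] H₂} (h : BlockSupp C D E t) : Approximable 𝒳 C.proj D.proj t :=
  fun ε hε => ⟨t, hasControlledPropagation_iff.2 ⟨E, hE, h⟩, by simp [hε.le]⟩

theorem Approximable.id (C : CoarseModule 𝒳 H₁) :
    Approximable 𝒳 C.proj C.proj (ContinuousLinearMap.id ℂ H₁) :=
  approximable_of_blockSupp 𝒳.disc_mem (BlockSupp.id C)

theorem Approximable.exists_blockSupp {t : H₁ →L[ℂ] H₂} (h : Approximable 𝒳 C.proj D.proj t)
    {ε : ℝ} (hε : 0 < ε) :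
    ∃ E ∈ 𝒳.coarse.entourages, ∃ s, BlockSupp C D E s ∧ ‖t - s‖ ≤ ε := by
  obtain ⟨s, hs, h⟩ := h ε hε
  obtain ⟨E, hE, hsE⟩ := hasControlledPropagation_iff.1 hs
  exact ⟨E, hE, s, hsE, h⟩

theorem Approximable.adjoint {t : H₁ →L[ℂ] H₂} (h : Approximable 𝒳 C.proj D.proj t) :
    Approximable 𝒳 D.proj C.proj (ContinuousLinearMap.adjoint t) := by
  intro ε hε
  obtain ⟨E, hE, s, hs, hle⟩ := h.exists_blockSupp hε
  refine ⟨ContinuousLinearMap.adjoint s, hasControlledPropagation_iff.2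
    ⟨_, 𝒳.coarse.transpose_mem hE, hs.adjoint⟩, ?_⟩
  rwa [← map_sub, LinearIsometryEquiv.norm_map]

theorem Approximable.add {s t : H₁ →L[ℂ] H₂} (hs : Approximable 𝒳 C.proj D.proj s)
    (ht : Approximable 𝒳 C.proj D.proj t) : Approximable 𝒳 C.proj D.proj (s + t) := by
  intro ε hε
  obtain ⟨E, hE, s', hs', hle⟩ := hs.exists_blockSupp (half_pos hε)
  obtain ⟨E', hE', t', ht', hle'⟩ := ht.exists_blockSupp (half_pos hε)
  refine ⟨s' + t', hasControlledPropagation_iff.2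
    ⟨_, 𝒳.coarse.union_mem hE hE', hs'.add ht'⟩, ?_⟩
  rw [add_sub_add_comm]
  exact (norm_add_le _ _).trans (by linarith)

theorem Approximable.smul {t : H₁ →L[ℂ] H₂} (c : ℂ)
    (ht : Approximable 𝒳 C.proj D.proj t) : Approximable 𝒳 C.proj D.proj (c • t) := by
  intro ε hε
  obtain ⟨E, hE, s, hs, hle⟩ := ht.exists_blockSupp (ε := ε / (‖c‖ + 1)) (by positivity)
  refine ⟨c • s, hasControlledPropagation_iff.2 ⟨_, hE, hs.smul c⟩, ?_⟩
  rw [← smul_sub, norm_smul]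
  calc ‖c‖ * ‖t - s‖ ≤ (‖c‖ + 1) * (ε / (‖c‖ + 1)) := by gcongr; linarith
    _ = ε := by field_simp

theorem Approximable.comp {s : H₂ →L[ℂ] H₃} {t : H₁ →L[ℂ] H₂}
    (hs : Approximable 𝒳 D.proj G.proj s) (ht : Approximable 𝒳 C.proj D.proj t) :
    Approximable 𝒳 C.proj G.proj (s ∘L t) := by
  intro ε hε
  obtain ⟨E, hE, t', ht', hle'⟩ := ht.exists_blockSupp (ε := ε / 2 / (‖s‖ + 1)) (by positivity)
  obtain ⟨E', hE', s', hs', hle⟩ := hs.exists_blockSupp (ε := ε / 2 / (‖t'‖ + 1)) (by positivity)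
  refine ⟨s' ∘L t', hasControlledPropagation_iff.2
    ⟨_, 𝒳.coarse.comp_mem hE' hE, hs'.comp ht'⟩, ?_⟩
  have : s ∘L t - s' ∘L t' = s ∘L (t - t') + (s - s') ∘L t' := by
    ext x; simp
  rw [this]
  refine (norm_add_le _ _).trans ?_
  have h1 : ‖s ∘L (t - t')‖ ≤ ε / 2 := by
    calc _ ≤ ‖s‖ * ‖t - t'‖ := ContinuousLinearMap.opNorm_comp_le _ _
      _ ≤ (‖s‖ + 1) * (ε / 2 / (‖s‖ + 1)) := by gcongr; linarith
      _ = ε / 2 := by field_simp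
  have h2 : ‖(s - s') ∘L t'‖ ≤ ε / 2 := by
    calc _ ≤ ‖s - s'‖ * ‖t'‖ := ContinuousLinearMap.opNorm_comp_le _ _
      _ ≤ (ε / 2 / (‖t'‖ + 1)) * (‖t'‖ + 1) := by gcongr; linarith
      _ = ε / 2 := by field_simp
  linarith

/-- Quasi-locality of an operator at scale `ε` with respect to the entourage `E`. -/
def QuasiLocal (C : CoarseModule 𝒳 H₁) (D : CoarseModule 𝒳 H₂) (ε : ℝ) (E : Set (X × X))
    (t : H₁ →L[ℂ] H₂) : Prop :=
  ∀ B' ∈ 𝒳.meas, ∀ B ∈ 𝒳.meas, (∀ y ∈ B', ∀ x ∈ B, (y, x) ∉ E) →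
    ∀ x, ‖D.proj B' (t (C.proj B x))‖ ≤ ε * ‖x‖

theorem QuasiLocal.mono {ε ε' : ℝ} {E E' : Set (X × X)} {t : H₁ →L[ℂ] H₂}
    (h : QuasiLocal C D ε E t) (hε : ε ≤ ε') (hE : E ⊆ E') : QuasiLocal C D ε' E' t :=
  fun B' hB' B hB hd x => (h B' hB' B hB (fun y hy x hx hm => hd y hy x hx (hE hm)) x).trans
    (by gcongr)

theorem Approximable.exists_quasiLocal {t : H₁ →L[ℂ] H₂} (h : Approximable 𝒳 C.proj D.proj t)
    {ε : ℝ} (hε : 0 < ε) : ∃ E ∈ 𝒳.coarse.entourages, QuasiLocal C D ε E t := by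
  obtain ⟨E, hE, s, hs, hle⟩ := h.exists_blockSupp hε
  refine ⟨E, hE, fun B' hB' B hB hd x => ?_⟩
  have h0 := hs.proj_comp_proj hB' hB hd x
  have : D.proj B' (t (C.proj B x)) = D.proj B' ((t - s) (C.proj B x)) := by
    rw [sub_apply, map_sub, h0, sub_zero]
  rw [this]
  refine (D.norm_proj_le hB' _).trans (((t - s).le_opNorm _).trans ?_)
  gcongr
  exact C.norm_proj_le hB x

end Support

/-! ## Partial isometries between orthonormal families -/

section PartialIsometry

variable [NormedAddCommGroup H₁] [InnerProductSpace ℂ H₁] [CompleteSpace H₁]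
variable [NormedAddCommGroup H₂] [InnerProductSpace ℂ H₂] [CompleteSpace H₂]
variable {N : Type} {u : N → H₁} {v : N → H₂}

/-- The partial isometry mapping the orthonormal family `u` to the orthonormal family `v`. -/
def partialIsom (hu : Orthonormal ℂ u) (hv : Orthonormal ℂ v) : H₁ →L[ℂ] H₂ :=
  hv.orthogonalFamily.linearIsometry.toContinuousLinearMap ∘L
    ContinuousLinearMap.adjoint hu.orthogonalFamily.linearIsometry.toContinuousLinearMap

theorem hasSum_partialIsom (hu : Orthonormal ℂ u) (hv : Orthonormal ℂ v) (x : H₁) :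
    HasSum (fun n => inner ℂ (u n) x • v n) (partialIsom hu hv x) := by
  classical
  have h := hv.orthogonalFamily.hasSum_linearIsometry
    (ContinuousLinearMap.adjoint hu.orthogonalFamily.linearIsometry.toContinuousLinearMap x)
  refine (funext fun n => ?_ : _ = fun n => inner ℂ (u n) x • v n) ▸ h
  rw [LinearIsometry.toSpanSingleton_apply]
  congr 1
  have h1 := hu.orthogonalFamily.linearIsometry_apply_single (i := n) (1 : ℂ)
  rw [LinearIsometry.toSpanSingleton_apply, one_smul] at h1
  rw [← h1]
  have h2 := ContinuousLinearMap.adjoint_inner_right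
    (hu.orthogonalFamily.linearIsometry.toContinuousLinearMap)
    (lp.single 2 n (1 : ℂ)) x
  rw [LinearIsometry.coe_toContinuousLinearMap] at h2
  rw [← h2, lp.inner_single_left]
  simp

theorem norm_partialIsom_apply_le (hu : Orthonormal ℂ u) (hv : Orthonormal ℂ v) (x : H₁) :
    ‖partialIsom hu hv x‖ ≤ ‖x‖ := by
  change ‖hv.orthogonalFamily.linearIsometry _‖ ≤ _
  rw [LinearIsometry.norm_map]
  refine (ContinuousLinearMap.le_opNorm (ContinuousLinearMap.adjoint
    hu.orthogonalFamily.linearIsometry.toContinuousLinearMap) x).trans ?_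
  rw [LinearIsometryEquiv.norm_map]
  refine mul_le_of_le_one_left (norm_nonneg _) ?_
  exact LinearIsometry.norm_toContinuousLinearMap_le _

theorem partialIsom_apply_self (hu : Orthonormal ℂ u) (hv : Orthonormal ℂ v) (n : N) :
    partialIsom hu hv (u n) = v n := by
  classical
  refine (hasSum_partialIsom hu hv (u n)).unique ?_
  convert hasSum_ite_eq n (v n) using 2 with m
  rw [orthonormal_iff_ite.1 hu]
  split_ifs with h
  · rw [h, one_smul]
  · rw [zero_smul]

variable {𝒳 : LFCMSpace X} {C : CoarseModule 𝒳 H₁} {D : CoarseModule 𝒳 H₂}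

theorem blockSupp_partialIsom (hu : Orthonormal ℂ u) (hv : Orthonormal ℂ v)
    {bu bv : N → Set X} (hbu : ∀ n, bu n ∈ 𝒳.partition) (hbv : ∀ n, bv n ∈ 𝒳.partition)
    (hu' : ∀ n, C.proj (bu n) (u n) = u n) (hv' : ∀ n, D.proj (bv n) (v n) = v n)
    {E : Set (X × X)} (hE : ∀ n, bv n ×ˢ bu n ⊆ E) :
    BlockSupp C D E (partialIsom hu hv) := by
  intro Q' hQ' Q hQ x hx
  by_contra hsub
  apply hx
  have hs := (hasSum_partialIsom hu hv (C.proj Q x)).mapL (D.proj Q')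
  refine hs.unique ?_
  convert hasSum_zero using 1
  ext n
  rw [map_smul]
  by_cases h1 : bv n = Q'
  · have h2 : bu n ≠ Q := by
      rintro rfl
      exact hsub (h1 ▸ hE n)
    rw [← C.inner_proj (𝒳.isPartition.measurable hQ), ← hu' n,
      C.proj_of_disjoint (𝒳.isPartition.measurable hQ) (𝒳.isPartition.measurable (hbu n))
        (𝒳.isPartition.pairwiseDisjoint _ hQ _ (hbu n) h2.symm), inner_zero_left, zero_smul]
  · rw [← hv' n, D.proj_of_disjoint (𝒳.isPartition.measurable hQ')
      (𝒳.isPartition.measurable (hbv n))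
        (𝒳.isPartition.pairwiseDisjoint _ hQ' _ (hbv n) (Ne.symm h1)), smul_zero]

end PartialIsometry

/-! ## Bases adapted to the partition -/

/-- A Hilbert basis of a coarse module all of whose vectors live in a single block. -/
structure AdaptedBasis {X H : Type} [NormedAddCommGroup H] [InnerProductSpace ℂ H]
    [CompleteSpace H] {𝒳 : LFCMSpace X} (M : CoarseModule 𝒳 H) where
  ι : Type
  basis : HilbertBasis ι ℂ H
  blk : ι → Set X
  blk_mem : ∀ i, blk i ∈ 𝒳.partition
  proj_blk : ∀ i, M.proj (blk i) (basis i) = basis i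

theorem AdaptedBasis.nonempty {X H : Type} [NormedAddCommGroup H] [InnerProductSpace ℂ H]
    [CompleteSpace H] {𝒳 : LFCMSpace X} (M : CoarseModule 𝒳 H) : Nonempty (AdaptedBasis M) := by
  have hcl : ∀ Q : 𝒳.partition, IsClosed ((M.proj Q).range : Set H) := by
    intro Q
    have : ((M.proj Q).range : Set H) = {x | M.proj Q x = x} := by
      ext x
      constructor
      · rintro ⟨y, rfl⟩
        exact M.proj_idem (𝒳.isPartition.measurable Q.2) y
      · intro h
        exact ⟨x, h⟩
    rw [this]
    exact isClosed_eq (M.proj Q).continuous continuous_id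
  have hc : ∀ Q : 𝒳.partition, CompleteSpace (M.proj Q).range :=
    fun Q => (hcl Q).completeSpace_coe
  have hb : ∀ Q : 𝒳.partition, ∃ (w : Set (M.proj Q).range)
      (b : HilbertBasis w ℂ (M.proj Q).range), ⇑b = ((↑) : w → (M.proj Q).range) :=
    fun Q => exists_hilbertBasis ℂ _
  choose w b hw using hb
  let v : (Σ Q : 𝒳.partition, w Q) → H := fun i => (b i.1 i.2 : H)
  have hv : ∀ i, M.proj i.1 (v i) = v i := by
    intro i
    obtain ⟨y, hy⟩ := (b i.1 i.2).2
    change M.proj i.1 (b i.1 i.2 : H) = (b i.1 i.2 : H)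
    rw [← hy]
    exact M.proj_idem (𝒳.isPartition.measurable i.1.2) y
  have hon : Orthonormal ℂ v := by
    constructor
    · intro i
      exact (b i.1).orthonormal.1 i.2
    · rintro ⟨Q, i⟩ ⟨Q', j⟩ hij
      by_cases h : Q = Q'
      · subst h
        have hij' : i ≠ j := fun h => hij (by rw [h])
        exact (b Q).orthonormal.2 hij'
      · rw [← hv ⟨Q, i⟩, ← hv ⟨Q', j⟩, M.inner_proj (𝒳.isPartition.measurable Q.2),
          M.proj_of_disjoint (𝒳.isPartition.measurable Q.2) (𝒳.isPartition.measurable Q'.2),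
          inner_zero_right]
        exact 𝒳.isPartition.pairwiseDisjoint _ Q.2 _ Q'.2 fun h' => h (Subtype.ext h')
  have hsp : (Submodule.span ℂ (Set.range v))ᗮ = ⊥ := by
    rw [eq_bot_iff]
    intro x hx
    rw [Submodule.mem_bot]
    refine M.eq_zero_of_proj_blocks fun Q hQ => ?_
    have h0 : (⟨M.proj Q x, ⟨x, rfl⟩⟩ : (M.proj Q).range) = 0 := by
      apply (b ⟨Q, hQ⟩).repr.injective
      rw [map_zero]
      ext i
      rw [HilbertBasis.repr_apply_apply]
      have h1 : inner ℂ (v ⟨⟨Q, hQ⟩, i⟩) x = 0 :=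
        Submodule.inner_right_of_mem_orthogonal (Submodule.subset_span (Set.mem_range_self _)) hx
      rw [← hv, M.inner_proj (𝒳.isPartition.measurable hQ)] at h1
      exact h1
    exact congrArg Subtype.val h0
  exact ⟨{ ι := Σ Q : 𝒳.partition, w Q
           basis := HilbertBasis.mkOfOrthogonalEqBot hon hsp
           blk := fun i => i.1
           blk_mem := fun i => i.1.2
           proj_blk := fun i => by
             rw [HilbertBasis.coe_mkOfOrthogonalEqBot]
             exact hv i }⟩

theorem HasSum.of_forall_eq {ι E : Type*} [AddCommMonoid E] [TopologicalSpace E] {f g : ι → E}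
    {a : E} (h : HasSum f a) (e : ∀ i, g i = f i) : HasSum g a :=
  (funext e : g = f) ▸ h

/-! ## Diagonal projections of an adapted basis -/

namespace AdaptedBasis

variable [NormedAddCommGroup H₁] [InnerProductSpace ℂ H₁] [CompleteSpace H₁]
variable {𝒳 : LFCMSpace X} {C : CoarseModule 𝒳 H₁} (b : AdaptedBasis C)

theorem orthonormal_restrict (J : Set b.ι) : Orthonormal ℂ fun i : J => b.basis i :=
  b.basis.orthonormal.comp _ Subtype.val_injective

/-- The orthogonal projection onto the span of the basis vectors with index in `J`. -/
def diag (J : Set b.ι) : H₁ →L[ℂ] H₁ :=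
  partialIsom (b.orthonormal_restrict J) (b.orthonormal_restrict J)

open Classical in
theorem hasSum_diag (J : Set b.ι) (x : H₁) :
    HasSum (fun i => if i ∈ J then inner ℂ (b.basis i) x • b.basis i else 0) (b.diag J x) := by
  have h := hasSum_partialIsom (b.orthonormal_restrict J) (b.orthonormal_restrict J) x
  exact (hasSum_subtype_iff_indicator (f := fun i => inner ℂ (b.basis i) x • b.basis i)).1 h

theorem approximable_diag (J : Set b.ι) : Approximable 𝒳 C.proj C.proj (b.diag J) := by
  refine approximable_of_blockSupp 𝒳.disc_mem (blockSupp_partialIsom _ _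
    (bu := fun i : J => b.blk i) (bv := fun i : J => b.blk i) (fun i => b.blk_mem i)
    (fun i => b.blk_mem i) (fun i => b.proj_blk i) (fun i => b.proj_blk i)
    fun i => LFCMSpace.block_prod_subset (b.blk_mem i))

open Classical in
theorem inner_diag (J : Set b.ι) (x : H₁) (i : b.ι) :
    inner ℂ (b.basis i) (b.diag J x) = if i ∈ J then inner ℂ (b.basis i) x else 0 := by
  have h := (b.hasSum_diag J x).mapL (innerSL ℂ (b.basis i))
  refine h.unique ((hasSum_ite_eq i (if i ∈ J then inner ℂ (b.basis i) x else 0)).of_forall_eq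
    fun j => ?_)
  rw [innerSL_apply_apply]
  by_cases hij : j = i
  · subst hij
    by_cases hj : j ∈ J
    · simp [hj, inner_smul_right, b.basis.orthonormal.1]
    · simp [hj]
  · have := b.basis.orthonormal.2 (Ne.symm hij)
    simp only at this
    split_ifs <;> simp [inner_smul_right, this]

theorem diag_union {J K : Set b.ι} (h : Disjoint J K) : b.diag (J ∪ K) = b.diag J + b.diag K := by
  classical
  ext x
  refine (b.hasSum_diag (J ∪ K) x).unique ?_
  rw [add_apply]
  refine ((b.hasSum_diag J x).add (b.hasSum_diag K x)).of_forall_eq fun i => ?_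
  by_cases hJ : i ∈ J
  · have hK : i ∉ K := Set.disjoint_left.1 h hJ
    simp [hJ, hK]
  · by_cases hK : i ∈ K <;> simp [hJ, hK]

theorem diag_univ (x : H₁) : b.diag Set.univ x = x := by
  classical
  refine (b.hasSum_diag Set.univ x).unique ?_
  simpa [HilbertBasis.repr_apply_apply] using b.basis.hasSum_repr x

theorem diag_finset (T : Finset b.ι) (x : H₁) :
    b.diag T x = ∑ i ∈ T, inner ℂ (b.basis i) x • b.basis i := by
  classical
  refine (b.hasSum_diag T x).unique ?_
  have key : ∀ f : b.ι → H₁, (∀ i ∈ T, f i = inner ℂ (b.basis i) x • b.basis i) →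
      (∀ i ∉ T, f i = 0) → HasSum f (∑ i ∈ T, inner ℂ (b.basis i) x • b.basis i) := by
    intro f h1 h2
    rw [← Finset.sum_congr rfl h1]
    exact hasSum_sum_of_ne_finset_zero h2
  exact key _ (fun i hi => if_pos hi) fun i hi => if_neg hi

theorem hasSum_norm_sq (x : H₁) : HasSum (fun i => ‖inner ℂ (b.basis i) x‖ ^ 2) (‖x‖ ^ 2) := by
  have h := (b.basis.hasSum_inner_mul_inner x x).mapL Complex.reCLM
  convert h using 1
  · ext i
    have : inner ℂ x (b.basis i) * inner ℂ (b.basis i) x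
        = ((‖inner ℂ (b.basis i) x‖ ^ 2 : ℝ) : ℂ) := by
      rw [← inner_conj_symm, Complex.conj_mul']
      push_cast
      rfl
    rw [this]
    exact (Complex.ofReal_re _).symm
  · have : (inner ℂ x x : ℂ) = ((‖x‖ ^ 2 : ℝ) : ℂ) := by
      rw [inner_self_eq_norm_sq_to_K]
      push_cast
      rfl
    rw [this]
    exact (Complex.ofReal_re _).symm

theorem norm_diag_sq_le (J : Set b.ι) (x : H₁) {c : ℝ}
    (h : ∀ T : Finset b.ι, ↑T ⊆ J → ∑ i ∈ T, ‖inner ℂ (b.basis i) x‖ ^ 2 ≤ c) :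
    ‖b.diag J x‖ ^ 2 ≤ c := by
  classical
  refine hasSum_le_of_sum_le (b.hasSum_norm_sq (b.diag J x)) fun s => ?_
  refine le_trans (le_of_eq ?_) (h (s.filter (· ∈ J)) fun i hi => by simp at hi; exact hi.2)
  rw [Finset.sum_filter]
  refine Finset.sum_congr rfl fun i _ => ?_
  rw [inner_diag]
  split_ifs <;> simp

theorem proj_basis_of_disjoint {A : Set X} (hA : A ∈ 𝒳.meas) {i : b.ι}
    (h : ¬ (b.blk i ∩ A).Nonempty) : C.proj A (b.basis i) = 0 := by
  rw [← b.proj_blk i]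
  refine C.proj_of_disjoint hA (𝒳.isPartition.measurable (b.blk_mem i)) ?_ _
  rwa [disjoint_comm, Set.disjoint_iff_inter_eq_empty, ← Set.not_nonempty_iff_eq_empty]

theorem norm_proj_le_norm_diag {A : Set X} (hA : A ∈ 𝒳.meas) (x : H₁) :
    ‖C.proj A x‖ ≤ ‖b.diag {i | (b.blk i ∩ A).Nonempty} x‖ := by
  classical
  set J := {i | (b.blk i ∩ A).Nonempty} with hJ
  have h0 : C.proj A (b.diag Jᶜ x) = 0 := by
    have h := (b.hasSum_diag Jᶜ x).mapL (C.proj A)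
    refine h.unique (hasSum_zero.of_forall_eq fun i => ?_)
    split_ifs with hi
    · rw [map_smul, b.proj_basis_of_disjoint hA hi, smul_zero]
    · rw [map_zero]
  have h1 : x = b.diag J x + b.diag Jᶜ x := by
    rw [← add_apply, ← b.diag_union disjoint_compl_right, Set.union_compl_self, diag_univ]
  conv_lhs => rw [h1, map_add, h0, add_zero]
  exact C.norm_proj_le hA _

theorem continuous_inner_diag (x y : H₁) :
    Continuous fun χ : b.ι → Bool => inner ℂ x (b.diag {i | χ i = true} y) := by
  classical
  have h : ∀ χ : b.ι → Bool, inner ℂ x (b.diag {i | χ i = true} y) =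
      ∑' i, if χ i = true then inner ℂ x (b.basis i) * inner ℂ (b.basis i) y else 0 := by
    intro χ
    have h := (b.hasSum_diag {i | χ i = true} y).mapL (innerSL ℂ x)
    rw [innerSL_apply_apply] at h
    rw [← h.tsum_eq]
    refine tsum_congr fun i => ?_
    rw [innerSL_apply_apply]
    simp only [Set.mem_ofPred_eq]
    split_ifs
    · rw [inner_smul_right, mul_comm]
    · rw [inner_zero_right]
  simp_rw [h]
  refine continuous_tsum (u := fun i => ‖inner ℂ x (b.basis i) * inner ℂ (b.basis i) y‖) ?_
    (b.basis.summable_inner_mul_inner x y).norm ?_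
  · intro i
    exact (continuous_of_discreteTopology (f := fun c : Bool => if c = true then
      inner ℂ x (b.basis i) * inner ℂ (b.basis i) y else 0)).comp (continuous_apply i)
  · intro i χ
    split_ifs
    · exact le_rfl
    · rw [norm_zero]
      exact norm_nonneg _

end AdaptedBasis

section QuasiLocal

variable {𝒳 : LFCMSpace X}
variable [NormedAddCommGroup H₁] [InnerProductSpace ℂ H₁] [CompleteSpace H₁]
variable [NormedAddCommGroup H₂] [InnerProductSpace ℂ H₂] [CompleteSpace H₂]
variable {C : CoarseModule 𝒳 H₁} {D : CoarseModule 𝒳 H₂}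

theorem QuasiLocal.add {ε ε' : ℝ} {E : Set (X × X)} {s t : H₁ →L[ℂ] H₂}
    (hs : QuasiLocal C D ε E s) (ht : QuasiLocal C D ε' E t) :
    QuasiLocal C D (ε + ε') E (s + t) := by
  intro B' hB' B hB hd x
  rw [add_apply, map_add, add_mul]
  exact (norm_add_le _ _).trans (add_le_add (hs B' hB' B hB hd x) (ht B' hB' B hB hd x))

theorem QuasiLocal.sub {ε ε' : ℝ} {E : Set (X × X)} {s t : H₁ →L[ℂ] H₂}
    (hs : QuasiLocal C D ε E s) (ht : QuasiLocal C D ε' E t) :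
    QuasiLocal C D (ε + ε') E (s - t) := by
  intro B' hB' B hB hd x
  rw [sub_apply, map_sub, add_mul]
  exact (norm_sub_le _ _).trans (add_le_add (hs B' hB' B hB hd x) (ht B' hB' B hB hd x))

end QuasiLocal

/-- Among all sums `∑ ± x i` some is at least as long as if the vectors were orthogonal. -/
theorem exists_signed_sum_norm_ge {ι E : Type*} [DecidableEq ι] [NormedAddCommGroup E]
    [InnerProductSpace ℂ E] (x : ι → E) (s : Finset ι) :
    ∃ T ⊆ s, ∑ i ∈ s, ‖x i‖ ^ 2 ≤ ‖∑ i ∈ T, x i - ∑ i ∈ s \ T, x i‖ ^ 2 := by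
  induction s using Finset.induction_on with
  | empty => exact ⟨∅, subset_rfl, by simp⟩
  | insert a s ha ih =>
    obtain ⟨T, hT, h⟩ := ih
    have haT : a ∉ T := fun h => ha (hT h)
    set w := ∑ i ∈ T, x i - ∑ i ∈ s \ T, x i with hw
    have hpar := parallelogram_law_with_norm ℂ w (x a)
    rw [Finset.sum_insert ha]
    by_cases hc : ‖w‖ ^ 2 + ‖x a‖ ^ 2 ≤ ‖w + x a‖ ^ 2
    · refine ⟨insert a T, Finset.insert_subset_insert _ hT, ?_⟩
      have h1 : insert a s \ insert a T = s \ T := by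
        ext i
        simp only [Finset.mem_sdiff, Finset.mem_insert]
        constructor
        · tauto
        · rintro ⟨h1, h2⟩
          refine ⟨Or.inr h1, ?_⟩
          rintro (rfl | h3)
          · exact ha h1
          · exact h2 h3
      rw [h1, Finset.sum_insert haT]
      have : x a + ∑ i ∈ T, x i - ∑ i ∈ s \ T, x i = w + x a := by rw [hw]; abel
      rw [this]
      linarith
    · refine ⟨T, hT.trans (Finset.subset_insert _ _), ?_⟩
      have h1 : insert a s \ T = insert a (s \ T) := Finset.insert_sdiff_of_notMem _ haT
      have h2 : a ∉ s \ T := fun h => ha (Finset.mem_sdiff.1 h).1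
      rw [h1, Finset.sum_insert h2]
      have : ∑ i ∈ T, x i - (x a + ∑ i ∈ s \ T, x i) = w - x a := by rw [hw]; abel
      rw [this]
      nlinarith

/-! ## Unitaries conjugating approximable operators to approximable operators -/

section Conj

variable [NormedAddCommGroup H₁] [InnerProductSpace ℂ H₁] [CompleteSpace H₁]
variable [NormedAddCommGroup H₂] [InnerProductSpace ℂ H₂] [CompleteSpace H₂]

/-- `U` is a unitary such that conjugation by `U` preserves approximability. -/
structure ConjApprox {𝒳 : LFCMSpace X} {𝒴 : LFCMSpace Y} (C : CoarseModule 𝒳 H₁)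
    (D : CoarseModule 𝒴 H₂) (U : H₁ →L[ℂ] H₂) : Prop where
  unitary : IsUnitaryOp U
  conj : ∀ t, Approximable 𝒳 C.proj C.proj t →
    Approximable 𝒴 D.proj D.proj (U ∘L t ∘L ContinuousLinearMap.adjoint U)

theorem IsUnitaryOp.adjoint_apply {U : H₁ →L[ℂ] H₂} (hU : IsUnitaryOp U) (x : H₁) :
    ContinuousLinearMap.adjoint U (U x) = x :=
  congrArg (fun s : H₁ →L[ℂ] H₁ => s x) hU.1

theorem IsUnitaryOp.inner_map {U : H₁ →L[ℂ] H₂} (hU : IsUnitaryOp U) (x y : H₁) :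
    inner ℂ (U x) (U y) = inner ℂ x y := by
  rw [← ContinuousLinearMap.adjoint_inner_right, hU.adjoint_apply]

theorem IsUnitaryOp.norm_map {U : H₁ →L[ℂ] H₂} (hU : IsUnitaryOp U) (x : H₁) :
    ‖U x‖ = ‖x‖ := by
  rw [@norm_eq_sqrt_re_inner ℂ, @norm_eq_sqrt_re_inner ℂ, hU.inner_map]

theorem IsUnitaryOp.adjoint {U : H₁ →L[ℂ] H₂} (hU : IsUnitaryOp U) :
    IsUnitaryOp (ContinuousLinearMap.adjoint U) :=
  ⟨by rw [ContinuousLinearMap.adjoint_adjoint]; exact hU.2,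
    by rw [ContinuousLinearMap.adjoint_adjoint]; exact hU.1⟩

variable {𝒳 : LFCMSpace X} {𝒴 : LFCMSpace Y} {C : CoarseModule 𝒳 H₁}
    {D : CoarseModule 𝒴 H₂} {U : H₁ →L[ℂ] H₂}

/-- The conjugates of the diagonal projections are uniformly quasi-local. -/
theorem ConjApprox.exists_uniform_quasiLocal (hU : ConjApprox C D U)
    (hY : 𝒴.coarse.IsCountablyGenerated) (b : AdaptedBasis C) {ε : ℝ} (hε : 0 < ε) :
    ∃ F ∈ 𝒴.coarse.entourages, ∀ J : Set b.ι,
      QuasiLocal D D ε F (U ∘L b.diag J ∘L ContinuousLinearMap.adjoint U) := by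
  classical
  obtain ⟨F, hFm, hF, hFc⟩ := CoarseSpace.exists_cofinal_seq hY
  have hε3 : 0 < ε / 3 := by positivity
  have hQ : ∀ J : Set b.ι, ∃ n, QuasiLocal D D (ε / 3) (F n)
      (U ∘L b.diag J ∘L ContinuousLinearMap.adjoint U) := by
    intro J
    obtain ⟨E, hE, h⟩ := (hU.conj _ (b.approximable_diag J)).exists_quasiLocal hε3
    obtain ⟨n, hn⟩ := hFc E hE
    exact ⟨n, h.mono le_rfl hn⟩
  let S : ℕ → Set (b.ι → Bool) := fun n => {χ | QuasiLocal D D (ε / 3) (F n)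
      (U ∘L b.diag {i | χ i = true} ∘L ContinuousLinearMap.adjoint U)}
  have hSc : ∀ n, IsClosed (S n) := by
    intro n
    have : S n = ⋂ B' ∈ 𝒴.meas, ⋂ B ∈ 𝒴.meas, ⋂ (_ : ∀ y ∈ B', ∀ x ∈ B, (y, x) ∉ F n),
        ⋂ x : H₂, ⋂ w : H₂, {χ : b.ι → Bool |
          ‖inner ℂ (ContinuousLinearMap.adjoint U (D.proj B' w)) (b.diag {i | χ i = true}
            (ContinuousLinearMap.adjoint U (D.proj B x)))‖ ≤ ε / 3 * ‖x‖ * ‖w‖} := by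
      ext χ
      simp only [S, Set.mem_ofPred_eq, QuasiLocal, Set.mem_iInter]
      refine forall₄_congr fun B' hB' B hB => forall₂_congr fun hd x => ?_
      have key : ∀ w, inner ℂ (ContinuousLinearMap.adjoint U (D.proj B' w))
          (b.diag {i | χ i = true} (ContinuousLinearMap.adjoint U (D.proj B x))) =
          inner ℂ w (D.proj B' ((U ∘L b.diag {i | χ i = true} ∘L
            ContinuousLinearMap.adjoint U) (D.proj B x))) := by
        intro w
        rw [ContinuousLinearMap.adjoint_inner_left, D.inner_proj hB']
        rfl
      simp_rw [key]
      constructor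
      · intro h w
        refine (norm_inner_le_norm _ _).trans ?_
        rw [mul_comm]
        gcongr
      · intro h
        refine (ContinuousLinearMap.opNorm_le_bound (innerSL ℂ (D.proj B'
          ((U ∘L b.diag {i | χ i = true} ∘L ContinuousLinearMap.adjoint U) (D.proj B x))))
          (M := ε / 3 * ‖x‖) (by positivity) fun w => ?_).trans' (innerSL_apply_norm _ _).ge
        rw [innerSL_apply_apply, norm_inner_symm]
        exact h w
    rw [this]
    refine isClosed_biInter fun B' _ => isClosed_biInter fun B _ => isClosed_iInter fun _ =>
      isClosed_iInter fun x => isClosed_iInter fun w => ?_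
    exact isClosed_le (b.continuous_inner_diag _ _).norm continuous_const
  have hSu : ⋃ n, S n = Set.univ := by
    rw [Set.eq_univ_iff_forall]
    intro χ
    obtain ⟨n, hn⟩ := hQ {i | χ i = true}
    exact Set.mem_iUnion.2 ⟨n, hn⟩
  obtain ⟨n, χ₀, hχ₀⟩ := nonempty_interior_of_iUnion_of_closed hSc hSu
  obtain ⟨s, u, hu, hsub⟩ := isOpen_pi_iff.1 isOpen_interior χ₀ hχ₀
  obtain ⟨F', hF', hfin⟩ := 𝒴.coarse.exists_finite_bound
    (s := {T : Set b.ι | T ⊆ s}) s.finite_toSet.finite_subsets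
    (fun T => F (hQ T).choose) fun T _ => hF _
  refine ⟨F n ∪ F', 𝒴.coarse.union_mem (hF n) hF', fun J => ?_⟩
  let K₀ : Set b.ι := {i | i ∈ s ∧ χ₀ i = true}
  let K : Set b.ι := (J \ s) ∪ K₀
  have h1 : QuasiLocal D D (ε / 3) (F n ∪ F')
      (U ∘L b.diag (J ∩ s) ∘L ContinuousLinearMap.adjoint U) :=
    (hQ (J ∩ s)).choose_spec.mono le_rfl
      ((hfin (J ∩ s) Set.inter_subset_right).trans Set.subset_union_right)
  have h2 : QuasiLocal D D (ε / 3) (F n ∪ F')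
      (U ∘L b.diag K₀ ∘L ContinuousLinearMap.adjoint U) :=
    (hQ K₀).choose_spec.mono le_rfl
      ((hfin K₀ fun i hi => hi.1).trans Set.subset_union_right)
  have h3 : QuasiLocal D D (ε / 3) (F n ∪ F')
      (U ∘L b.diag K ∘L ContinuousLinearMap.adjoint U) := by
    have hm : (fun i => decide (i ∈ K)) ∈ S n := by
      refine interior_subset (hsub ?_)
      intro i hi
      have : decide (i ∈ K) = χ₀ i := by
        have hi' : i ∈ s := hi
        rw [Bool.eq_iff_iff, decide_eq_true_iff]
        simp [K, K₀, hi']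
      change decide (i ∈ K) ∈ u i
      rw [this]
      exact (hu i hi).2
    have hK : {i | (fun i => decide (i ∈ K)) i = true} = K := by ext i; simp
    have hm' : QuasiLocal D D (ε / 3) (F n) (U ∘L b.diag
      {i | (fun i => decide (i ∈ K)) i = true} ∘L ContinuousLinearMap.adjoint U) := hm
    rw [hK] at hm'
    exact hm'.mono le_rfl Set.subset_union_left
  have hJ : b.diag J = b.diag (J ∩ s) + b.diag K - b.diag K₀ := by
    have e1 : b.diag K = b.diag (J \ s) + b.diag K₀ :=
      b.diag_union (Set.disjoint_left.2 fun i hi hi' => hi.2 hi'.1)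
    have e2 : b.diag J = b.diag (J ∩ s) + b.diag (J \ s) := by
      rw [← b.diag_union (Set.disjoint_left.2 fun i hi hi' => hi'.2 hi.2),
        Set.inter_union_sdiff]
    rw [e1, e2]
    abel
  have hsum := (h1.add h3).sub h2
  have e : U ∘L b.diag J ∘L ContinuousLinearMap.adjoint U =
      U ∘L b.diag (J ∩ s) ∘L ContinuousLinearMap.adjoint U +
      U ∘L b.diag K ∘L ContinuousLinearMap.adjoint U -
      U ∘L b.diag K₀ ∘L ContinuousLinearMap.adjoint U := by
    rw [hJ]
    ext x
    simp
  rw [e]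
  exact hsum.mono (by linarith) subset_rfl

/-- If the vector `z` is supported in `B` and `U* z` has a large component along the basis
vectors from `J`, then `U` moves one of these close to `B`, up to a small error. -/
theorem ConjApprox.exists_concentrated (hU : ConjApprox C D U)
    (hY : 𝒴.coarse.IsCountablyGenerated) (b : AdaptedBasis C) {η δ : ℝ} (hη : 0 < η)
    (hδ : 0 < δ) :
    ∃ F ∈ 𝒴.coarse.entourages, ∀ B ∈ 𝒴.meas, ∀ z, D.proj B z = z → ∀ J : Set b.ι,
      δ * ‖z‖ < ‖b.diag J (ContinuousLinearMap.adjoint U z)‖ →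
      ∃ i ∈ J, ‖D.proj (𝒴.fatten F B)ᶜ (U (b.basis i))‖ ≤ η := by
  classical
  obtain ⟨F, hF, hQ⟩ := hU.exists_uniform_quasiLocal hY b (ε := η * δ / 2) (by positivity)
  refine ⟨F, hF, fun B hB z hz J hJ => ?_⟩
  by_contra! hcon
  set N := (𝒴.fatten F B)ᶜ with hN
  have hNm : N ∈ 𝒴.meas := 𝒴.compl_mem (LFCMSpace.fatten_mem F B)
  have hd : ∀ y ∈ N, ∀ x ∈ B, (y, x) ∉ F := fun y hy x hx h =>
    hy (LFCMSpace.mem_fatten.2 ⟨y, LFCMSpace.disc_refl y, x, hx, h⟩)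
  set w := ContinuousLinearMap.adjoint U z with hw
  have hbound : ∀ T : Finset b.ι, ‖D.proj N (U (b.diag T w))‖ ≤ η * δ / 2 * ‖z‖ := by
    intro T
    have := hQ T N hNm B hB hd z
    rw [hz] at this
    exact this
  refine absurd hJ (not_lt.2 (abs_le_of_sq_le_sq' (?_ : _ ≤ (δ * ‖z‖) ^ 2) (by positivity)).2)
  refine b.norm_diag_sq_le J w fun T hT => ?_
  obtain ⟨T', hT', h⟩ := exists_signed_sum_norm_ge
    (fun i => inner ℂ (b.basis i) w • D.proj N (U (b.basis i))) T
  have hs : ∀ T : Finset b.ι, ∑ i ∈ T, inner ℂ (b.basis i) w • D.proj N (U (b.basis i)) =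
      D.proj N (U (b.diag T w)) := by
    intro T
    rw [b.diag_finset, map_sum, map_sum]
    simp only [map_smul]
  rw [hs, hs] at h
  have h1 : ‖D.proj N (U (b.diag T' w)) - D.proj N (U (b.diag ↑(T \ T') w))‖
      ≤ η * (δ * ‖z‖) := by
    refine (norm_sub_le _ _).trans ?_
    have := hbound T'
    have := hbound (T \ T')
    linarith
  have h2 : η ^ 2 * ∑ i ∈ T, ‖inner ℂ (b.basis i) w‖ ^ 2 ≤
      ∑ i ∈ T, ‖inner ℂ (b.basis i) w • D.proj N (U (b.basis i))‖ ^ 2 := by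
    rw [Finset.mul_sum]
    refine Finset.sum_le_sum fun i hi => ?_
    rw [norm_smul, mul_pow, mul_comm]
    gcongr
    exact (hcon i (hT hi)).le
  have h3 : η ^ 2 * ∑ i ∈ T, ‖inner ℂ (b.basis i) w‖ ^ 2 ≤ η ^ 2 * (δ * ‖z‖) ^ 2 := by
    refine h2.trans (h.trans ?_)
    rw [← mul_pow]
    gcongr
  exact le_of_mul_le_mul_left h3 (by positivity)

end Conj

/-! ## Coarse control of approximate relations -/

/-- A uniformity principle for families of relations `good n` that are uniform along injective
sequences of close pairs. -/
theorem exists_uniform_good {I : Type} (near : I → I → Prop) (good : ℕ → I → I → Prop)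
    (hrefl : ∀ i, near i i) (hsymm : ∀ i j, near i j → near j i)
    (hmono : ∀ n m, n ≤ m → ∀ i j, good n i j → good m i j)
    (gsymm : ∀ n, ∃ m, ∀ i j, good n i j → good m j i)
    (gtrans : ∀ n n', ∃ m, ∀ i j k, good n i j → good n' j k → good m i k)
    (hseq : ∀ (N : Type) (u v : N → I), Function.Injective u → Function.Injective v →
      (∀ n, ∃ k, near (u n) k ∧ near k (v n)) → ∃ m, ∀ n, good m (u n) (v n)) :
    ∃ m, ∀ i j, near i j → good m i j := by
  classical
  have h1 : ∃ (S : Finset I) (n : ℕ), ∀ i ∉ S, ∀ j ∉ S, (∃ k, near i k ∧ near k j) →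
      good n i j := by
    by_contra! hcon
    obtain ⟨f, hf, hlt⟩ := exists_seq_of_forall_finset_exists
      (fun p : I × I × ℕ => (∃ k, near p.1 k ∧ near k p.2.1) ∧ ¬ good p.2.2 p.1 p.2.1)
      (fun p q => p.1 ≠ q.1 ∧ p.2.1 ≠ q.2.1 ∧ p.2.2 < q.2.2) (by
        intro s _
        obtain ⟨i, hi, j, hj, hn, hg⟩ := hcon (s.image (fun p => p.1) ∪ s.image (fun p => p.2.1))
          ((s.image fun p => p.2.2).sup id + 1)
        refine ⟨(i, j, _), ⟨hn, hg⟩, fun p hp => ⟨?_, ?_, ?_⟩⟩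
        · rintro rfl
          exact hi (Finset.mem_union_left _ (Finset.mem_image_of_mem _ hp))
        · rintro rfl
          exact hj (Finset.mem_union_right _ (Finset.mem_image_of_mem (fun p => p.2.1) hp))
        · exact Nat.lt_succ_of_le (Finset.le_sup (f := id)
            (Finset.mem_image_of_mem (fun p : I × I × ℕ => p.2.2) hp)))
    have hlev : ∀ n, n ≤ (f n).2.2 := by
      intro n
      induction n with
      | zero => exact Nat.zero_le _
      | succ n ih => exact Nat.succ_le_of_lt (ih.trans_lt (hlt n (n + 1) n.lt_succ_self).2.2)
    obtain ⟨m, hm⟩ := hseq ℕ (fun n => (f n).1) (fun n => (f n).2.1)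
      (Function.Injective.of_lt_imp_ne fun a b hab => (hlt a b hab).1)
      (Function.Injective.of_lt_imp_ne fun a b hab => (hlt a b hab).2.1) (fun n => (hf n).1)
    exact (hf m).2 (hmono m _ (hlev m) _ _ (hm m))
  obtain ⟨S, n, hS⟩ := h1
  have hsingle : ∀ i j, ∃ m, near i j → good m i j := by
    intro i j
    by_cases h : near i j
    · obtain ⟨m, hm⟩ := hseq Unit (fun _ => i) (fun _ => j) (fun _ _ _ => rfl) (fun _ _ _ => rfl)
        fun _ => ⟨i, hrefl i, h⟩
      exact ⟨m, fun _ => hm ()⟩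
    · exact ⟨0, fun h' => absurd h' h⟩
  choose M hM using hsingle
  let m₁ : ℕ := (S ×ˢ S).sup fun p => M p.1 p.2
  let φ : I → I := fun i => if h : ∃ k ∉ S, near i k then h.choose else i
  have hφ : ∀ i, (∃ k ∉ S, near i k) → φ i ∉ S ∧ near i (φ i) := by
    intro i h
    simp only [φ, dif_pos h]
    exact h.choose_spec
  let m₂ : ℕ := S.sup fun i => M i (φ i)
  obtain ⟨m₃, hm₃⟩ := gtrans m₂ n
  obtain ⟨m₄, hm₄⟩ := gsymm m₃
  have hmixed : ∀ i ∈ S, ∀ j ∉ S, near i j → good m₃ i j := by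
    intro i hi j hj hij
    obtain ⟨hk, hik⟩ := hφ i ⟨j, hj, hij⟩
    refine hm₃ i (φ i) j (hmono _ _ (Finset.le_sup (f := fun i => M i (φ i)) hi) _ _
      (hM i (φ i) hik)) ?_
    exact hS _ hk _ hj ⟨i, hsymm _ _ hik, hij⟩
  refine ⟨max (max n m₁) (max m₃ m₄), fun i j hij => ?_⟩
  by_cases hi : i ∈ S <;> by_cases hj : j ∈ S
  · refine hmono _ _ ?_ _ _ (hM i j hij)
    have : M i j ≤ m₁ := Finset.le_sup (f := fun p : I × I => M p.1 p.2)
      (Finset.mk_mem_product hi hj)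
    omega
  · exact hmono _ _ (by omega) _ _ (hmixed i hi j hj hij)
  · exact hmono _ _ (by omega) _ _ (hm₄ _ _ (hmixed j hj i hi (hsymm _ _ hij)))
  · exact hmono _ _ (by omega) _ _ (hS i hi j hj ⟨i, hrefl i, hij⟩)

theorem exists_lt_norm_apply [NormedAddCommGroup H₁] [InnerProductSpace ℂ H₁]
    [NormedAddCommGroup H₂] [InnerProductSpace ℂ H₂]
    {T : H₁ →L[ℂ] H₂} {δ : ℝ} (hδ : 0 ≤ δ) (h : δ < ‖T‖) :
    ∃ z, δ * ‖z‖ < ‖T z‖ := by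
  by_contra! hcon
  exact absurd (T.opNorm_le_bound hδ hcon) (not_le.2 h)

section Control

variable [NormedAddCommGroup H₁] [InnerProductSpace ℂ H₁] [CompleteSpace H₁]
variable [NormedAddCommGroup H₂] [InnerProductSpace ℂ H₂] [CompleteSpace H₂]
variable {𝒳 : LFCMSpace X} {𝒴 : LFCMSpace Y} {C : CoarseModule 𝒳 H₁}
    {D : CoarseModule 𝒴 H₂} {U : H₁ →L[ℂ] H₂}

/-- The image of the `i`-th basis vector under `U` is concentrated near the bounded set `B`. -/
structure Concentrated (D : CoarseModule 𝒴 H₂) (U : H₁ →L[ℂ] H₂) (b : AdaptedBasis C)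
    (F₀ F' : Set (Y × Y)) (i : b.ι) (B : Set Y) : Prop where
  meas : B ∈ 𝒴.meas
  bdd : B ×ˢ B ⊆ F'
  norm_le : ‖D.proj (𝒴.fatten F₀ B)ᶜ (U (b.basis i))‖ ≤ 1 / 4

/-- Images of pairs of basis vectors matched by an approximable partial isometry are
concentrated at uniformly bounded distance. -/
theorem ConjApprox.exists_concentrated_near (hU : ConjApprox C D U) (b : AdaptedBasis C)
    {F₀ F' : Set (Y × Y)} (hF₀ : F₀ ∈ 𝒴.coarse.entourages)
    {N : Type} {u v : N → b.ι} (hu : Function.Injective u) (hv : Function.Injective v)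
    {E : Set (X × X)} (hE : E ∈ 𝒳.coarse.entourages)
    (hE' : ∀ n, b.blk (u n) ×ˢ b.blk (v n) ⊆ E) :
    ∃ G ∈ 𝒴.coarse.entourages, ∀ n B B', Concentrated D U b F₀ F' (u n) B →
      Concentrated D U b F₀ F' (v n) B' → ∃ y ∈ B, ∃ y' ∈ B', (y, y') ∈ G := by
  have hou : Orthonormal ℂ fun n => b.basis (u n) := b.basis.orthonormal.comp _ hu
  have hov : Orthonormal ℂ fun n => b.basis (v n) := b.basis.orthonormal.comp _ hv
  set T : H₁ →L[ℂ] H₁ := partialIsom hov hou with hT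
  have hTa : Approximable 𝒳 C.proj C.proj T := approximable_of_blockSupp hE
    (blockSupp_partialIsom hov hou (fun n => b.blk_mem (v n)) (fun n => b.blk_mem (u n))
      (fun n => b.proj_blk (v n)) (fun n => b.proj_blk (u n)) hE')
  obtain ⟨F, hF, hQ⟩ := (hU.conj T hTa).exists_quasiLocal (ε := 1 / 4) (by norm_num)
  have hG₀ : RelComp 𝒴.disc F₀ ∈ 𝒴.coarse.entourages := 𝒴.coarse.comp_mem 𝒴.disc_mem hF₀
  refine ⟨RelComp (RelTrans (RelComp 𝒴.disc F₀)) (RelComp F (RelComp 𝒴.disc F₀)),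
    𝒴.coarse.comp_mem (𝒴.coarse.transpose_mem hG₀) (𝒴.coarse.comp_mem hF hG₀), ?_⟩
  intro n B B' hB hB'
  by_contra! hcon
  have hm := LFCMSpace.fatten_mem (𝒳 := 𝒴) F₀ B
  have hm' := LFCMSpace.fatten_mem (𝒳 := 𝒴) F₀ B'
  have hapart : ∀ y ∈ 𝒴.fatten F₀ B, ∀ y' ∈ 𝒴.fatten F₀ B', (y, y') ∉ F := by
    intro y hy y' hy' h
    obtain ⟨z, hyz, x, hx, hzx⟩ := LFCMSpace.mem_fatten.1 hy
    obtain ⟨z', hyz', x', hx', hzx'⟩ := LFCMSpace.mem_fatten.1 hy'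
    exact hcon x hx x' hx' ⟨y, ⟨z, hyz, hzx⟩, y', h, z', hyz', hzx'⟩
  set p := U (b.basis (u n)) with hp
  set q := U (b.basis (v n)) with hq
  set R := U ∘L T ∘L ContinuousLinearMap.adjoint U with hR
  have hRq : R q = p := by
    change U (T (ContinuousLinearMap.adjoint U (U (b.basis (v n))))) = p
    rw [hU.unitary.adjoint_apply, hT, partialIsom_apply_self hov hou n]
  have hRn : ∀ w, ‖R w‖ ≤ ‖w‖ := by
    intro w
    change ‖U (T (ContinuousLinearMap.adjoint U w))‖ ≤ _
    rw [hU.unitary.norm_map]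
    exact (norm_partialIsom_apply_le _ _ _).trans (hU.unitary.adjoint.norm_map w).le
  have hpn : ‖p‖ = 1 := by rw [hp, hU.unitary.norm_map, b.basis.orthonormal.1]
  have hqn : ‖q‖ = 1 := by rw [hq, hU.unitary.norm_map, b.basis.orthonormal.1]
  have h1 := hQ _ hm _ hm' hapart q
  have h2 : D.proj (𝒴.fatten F₀ B) p = D.proj (𝒴.fatten F₀ B) (R (D.proj (𝒴.fatten F₀ B') q)) +
      D.proj (𝒴.fatten F₀ B) (R (D.proj (𝒴.fatten F₀ B')ᶜ q)) := by
    rw [← map_add, ← map_add, D.proj_add_compl hm', hRq]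
  have h3 : ‖D.proj (𝒴.fatten F₀ B) (R (D.proj (𝒴.fatten F₀ B')ᶜ q))‖ ≤ 1 / 4 :=
    (D.norm_proj_le hm _).trans ((hRn _).trans hB'.norm_le)
  have h4 : ‖p‖ ≤ ‖D.proj (𝒴.fatten F₀ B) p‖ + ‖D.proj (𝒴.fatten F₀ B)ᶜ p‖ := by
    conv_lhs => rw [← D.proj_add_compl hm p]
    exact norm_add_le _ _
  have h5 := hB.norm_le
  rw [h2] at h4
  have h6 := norm_add_le (D.proj (𝒴.fatten F₀ B) (R (D.proj (𝒴.fatten F₀ B') q)))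
    (D.proj (𝒴.fatten F₀ B) (R (D.proj (𝒴.fatten F₀ B')ᶜ q)))
  rw [hqn] at h1
  linarith

/-- Images of close basis vectors are concentrated near sets at uniformly bounded distance. -/
theorem ConjApprox.concentrated_controlled (hU : ConjApprox C D U)
    (hY : 𝒴.coarse.IsCountablyGenerated) (b : AdaptedBasis C)
    {F₀ F' : Set (Y × Y)} (hF₀ : F₀ ∈ 𝒴.coarse.entourages) (hF' : F' ∈ 𝒴.coarse.entourages)
    {E : Set (X × X)} (hE : E ∈ 𝒳.coarse.entourages) :
    ∃ G ∈ 𝒴.coarse.entourages, ∀ i j, (∃ x ∈ b.blk i, ∃ x' ∈ b.blk j, (x, x') ∈ E) →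
      ∀ B B', Concentrated D U b F₀ F' i B → Concentrated D U b F₀ F' j B' → B ×ˢ B' ⊆ G := by
  obtain ⟨F, hFm, hF, hFc⟩ := CoarseSpace.exists_cofinal_seq hY
  set E' := (E ∪ RelTrans E) ∪ {p : X × X | p.1 = p.2} with hE'
  have hE'm : E' ∈ 𝒳.coarse.entourages :=
    𝒳.coarse.union_mem (𝒳.coarse.union_mem hE (𝒳.coarse.transpose_mem hE)) 𝒳.coarse.diagonal_mem
  have hE'symm : ∀ x x', (x, x') ∈ E' → (x', x) ∈ E' := by
    rintro x x' ((h | h) | h)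
    · exact Or.inl (Or.inr h)
    · exact Or.inl (Or.inl h)
    · exact Or.inr (Eq.symm h)
  let I := {i : b.ι // ∃ B, Concentrated D U b F₀ F' i B}
  let near : I → I → Prop := fun i j => ∃ x ∈ b.blk i.1, ∃ x' ∈ b.blk j.1, (x, x') ∈ E'
  let good : ℕ → I → I → Prop := fun m i j => ∀ B B', Concentrated D U b F₀ F' i.1 B →
    Concentrated D U b F₀ F' j.1 B' → ∃ y ∈ B, ∃ y' ∈ B', (y, y') ∈ F m
  obtain ⟨m, hm⟩ := exists_uniform_good near good
    (by
      intro i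
      obtain ⟨x, hx⟩ := 𝒳.isPartition.nonempty _ (b.blk_mem i.1)
      exact ⟨x, hx, x, hx, Or.inr rfl⟩)
    (by
      rintro i j ⟨x, hx, x', hx', h⟩
      exact ⟨x', hx', x, hx, hE'symm _ _ h⟩)
    (by
      intro n m hnm i j h B B' hB hB'
      obtain ⟨y, hy, y', hy', hyy⟩ := h B B' hB hB'
      exact ⟨y, hy, y', hy', hFm hnm hyy⟩)
    (by
      intro n
      obtain ⟨m, hm⟩ := hFc _ (𝒴.coarse.transpose_mem (hF n))
      refine ⟨m, fun i j h B B' hB hB' => ?_⟩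
      obtain ⟨y, hy, y', hy', hyy⟩ := h B' B hB' hB
      exact ⟨y', hy', y, hy, hm hyy⟩)
    (by
      intro n n'
      obtain ⟨m, hm⟩ := hFc _ (𝒴.coarse.comp_mem (hF n) (𝒴.coarse.comp_mem hF' (hF n')))
      refine ⟨m, fun i j k h h' B B' hB hB' => ?_⟩
      obtain ⟨K, hK⟩ := j.2
      obtain ⟨y, hy, y', hy', hyy⟩ := h B K hB hK
      obtain ⟨z, hz, z', hz', hzz⟩ := h' K B' hK hB'
      exact ⟨y, hy, z', hz', hm ⟨y', hyy, z, hK.bdd ⟨hy', hz⟩, hzz⟩⟩)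
    (by
      intro N u v hu hv hn
      obtain ⟨G, hG, h⟩ := hU.exists_concentrated_near b (F' := F') hF₀
        (u := fun n => (u n).1) (v := fun n => (v n).1)
        (Subtype.val_injective.comp hu) (Subtype.val_injective.comp hv)
        (𝒳.coarse.comp_mem 𝒳.disc_mem (𝒳.coarse.comp_mem hE'm (𝒳.coarse.comp_mem 𝒳.disc_mem
          (𝒳.coarse.comp_mem hE'm 𝒳.disc_mem)))) (by
          rintro n ⟨a, c⟩ ⟨ha, hc⟩
          obtain ⟨k, ⟨x, hx, x', hx', hxx⟩, z, hz, z', hz', hzz⟩ := hn n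
          exact ⟨x, LFCMSpace.block_prod_subset (b.blk_mem _) ⟨ha, hx⟩, x', hxx, z,
            LFCMSpace.block_prod_subset (b.blk_mem _) ⟨hx', hz⟩, z', hzz,
            LFCMSpace.block_prod_subset (b.blk_mem _) ⟨hz', hc⟩⟩)
      obtain ⟨m, hm⟩ := hFc G hG
      refine ⟨m, fun n B B' hB hB' => ?_⟩
      obtain ⟨y, hy, y', hy', hyy⟩ := h n B B' hB hB'
      exact ⟨y, hy, y', hy', hm hyy⟩)
  refine ⟨_, 𝒴.coarse.comp_mem hF' (𝒴.coarse.comp_mem (hF m) hF'), ?_⟩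
  rintro i j ⟨x, hx, x', hx', hxx⟩ B B' hB hB' ⟨y, y'⟩ ⟨hy, hy'⟩
  obtain ⟨z, hz, z', hz', hzz⟩ := hm ⟨i, B, hB⟩ ⟨j, B', hB'⟩
    ⟨x, hx, x', hx', Or.inl (Or.inl hxx)⟩ B B' hB hB'
  exact ⟨z, hB.bdd ⟨hy, hz⟩, z', hzz, hB'.bdd ⟨hz', hy'⟩⟩

theorem norm_proj_adjoint {B : Set Y} {A : Set X} (hB : B ∈ 𝒴.meas) (hA : A ∈ 𝒳.meas) :
    ‖C.proj A ∘L ContinuousLinearMap.adjoint U ∘L D.proj B‖ = ‖D.proj B ∘L U ∘L C.proj A‖ := by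
  rw [← LinearIsometryEquiv.norm_map ContinuousLinearMap.adjoint (D.proj B ∘L U ∘L C.proj A),
    ContinuousLinearMap.adjoint_comp, ContinuousLinearMap.adjoint_comp,
    ContinuousLinearMap.isSelfAdjoint_iff'.1 (C.proj_selfAdjoint A hA),
    ContinuousLinearMap.isSelfAdjoint_iff'.1 (D.proj_selfAdjoint B hB)]
  rfl

theorem mem_approxRel_adjoint {δ : ℝ} {F' : Set (Y × Y)} {E : Set (X × X)} {x : X} {y : Y} :
    (x, y) ∈ approxRel 𝒴 𝒳 D.proj C.proj (ContinuousLinearMap.adjoint U) δ E F' ↔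
      (y, x) ∈ approxRel 𝒳 𝒴 C.proj D.proj U δ F' E := by
  constructor
  · rintro ⟨-, ⟨A, B, rfl, hA, hAE, hB, hBF, h⟩, hx, hy⟩
    rw [norm_proj_adjoint hB hA] at h
    exact ⟨_, ⟨B, A, rfl, hB, hBF, hA, hAE, h⟩, hy, hx⟩
  · rintro ⟨-, ⟨B, A, rfl, hB, hBF, hA, hAE, h⟩, hy, hx⟩
    rw [← norm_proj_adjoint hB hA] at h
    exact ⟨_, ⟨A, B, rfl, hA, hAE, hB, hBF, h⟩, hx, hy⟩

theorem approxRel_mono {δ δ' : ℝ} (hδ : δ' ≤ δ) {F' F'' : Set (Y × Y)} (hF : F' ⊆ F'')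
    {E E' : Set (X × X)} (hE : E ⊆ E') :
    approxRel 𝒳 𝒴 C.proj D.proj U δ F' E ⊆ approxRel 𝒳 𝒴 C.proj D.proj U δ' F'' E' := by
  rintro p ⟨S, ⟨B, A, rfl, hB, hBF, hA, hAE, h⟩, hp⟩
  exact ⟨_, ⟨B, A, rfl, hB, hBF.trans hF, hA, hAE.trans hE, hδ.trans_lt h⟩, hp⟩

/-- Approximate relations of `U` are controlled. -/
theorem ConjApprox.approxRel_controlled (hU : ConjApprox C D U)
    (hY : 𝒴.coarse.IsCountablyGenerated) {δ : ℝ} (hδ : 0 < δ)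
    {F' : Set (Y × Y)} (hF' : F' ∈ 𝒴.coarse.entourages)
    {E E' : Set (X × X)} (hE : E ∈ 𝒳.coarse.entourages) (hE' : E' ∈ 𝒳.coarse.entourages) :
    ∃ G ∈ 𝒴.coarse.entourages, ∀ y x y' x',
      (y, x) ∈ approxRel 𝒳 𝒴 C.proj D.proj U δ F' E →
      (y', x') ∈ approxRel 𝒳 𝒴 C.proj D.proj U δ F' E → (x, x') ∈ E' → (y, y') ∈ G := by
  obtain ⟨b⟩ := AdaptedBasis.nonempty C
  obtain ⟨F₀, hF₀, hcon⟩ := hU.exists_concentrated hY b (η := 1 / 4) (by norm_num) hδ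
  have key : ∀ y x, (y, x) ∈ approxRel 𝒳 𝒴 C.proj D.proj U δ F' E →
      ∃ i B, y ∈ B ∧ Concentrated D U b F₀ F' i B ∧ ∃ a ∈ b.blk i, (a, x) ∈ E := by
    rintro y x ⟨-, ⟨B, A, rfl, hB, hBF, hA, hAE, h⟩, hy, hx⟩
    rw [← norm_proj_adjoint hB hA] at h
    obtain ⟨z, hz⟩ := exists_lt_norm_apply hδ.le h
    obtain ⟨i, ⟨a, hai, haA⟩, hi⟩ := hcon B hB (D.proj B z) (D.proj_idem hB z)
      {i | (b.blk i ∩ A).Nonempty} (by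
        refine lt_of_le_of_lt ?_ (hz.trans_le (b.norm_proj_le_norm_diag hA
          (ContinuousLinearMap.adjoint U (D.proj B z))))
        gcongr
        exact D.norm_proj_le hB z)
    exact ⟨i, B, hy, ⟨hB, hBF, hi⟩, a, hai, hAE ⟨haA, hx⟩⟩
  obtain ⟨G, hG, h⟩ := hU.concentrated_controlled hY b hF₀ hF'
    (𝒳.coarse.comp_mem hE (𝒳.coarse.comp_mem hE' (𝒳.coarse.transpose_mem hE)))
  refine ⟨G, hG, fun y x y' x' hyx hyx' hxx => ?_⟩
  obtain ⟨i, B, hy, hB, a, ha, hax⟩ := key y x hyx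
  obtain ⟨j, B', hy', hB', a', ha', hax'⟩ := key y' x' hyx'
  exact h i j ⟨a, ha, a', ha', x, hax, x', hxx, hax'⟩ B B' hB hB' ⟨hy, hy'⟩

/-- Approximate relations of `U` are densely defined on the support of the module. -/
theorem ConjApprox.exists_mem_approxRel
    (hU : ConjApprox D C (ContinuousLinearMap.adjoint U))
    (hX : 𝒳.coarse.IsCountablyGenerated) {δ : ℝ} (hδ0 : 0 < δ) (hδ1 : δ < 1) :
    ∃ E₀ ∈ 𝒳.coarse.entourages, ∃ E₁ ∈ 𝒳.coarse.entourages, ∀ A ∈ 𝒳.meas, A ×ˢ A ⊆ 𝒳.disc →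
      C.proj A ≠ 0 → ∃ y x, (y, x) ∈ approxRel 𝒳 𝒴 C.proj D.proj U δ 𝒴.disc E₀ ∧
        ∃ a ∈ A, (x, a) ∈ E₁ := by
  obtain ⟨g⟩ := AdaptedBasis.nonempty D
  obtain ⟨E, hE, hcon⟩ := hU.exists_concentrated hX g (η := (1 - δ) / 2) (δ := 1 / 2)
    (by linarith) (by norm_num)
  have hE₁ : RelComp 𝒳.disc E ∈ 𝒳.coarse.entourages := 𝒳.coarse.comp_mem 𝒳.disc_mem hE
  refine ⟨_, 𝒳.coarse.comp_mem hE₁ (𝒳.coarse.comp_mem 𝒳.disc_mem (𝒳.coarse.transpose_mem hE₁)),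
    _, hE₁, fun A hA hAd hne => ?_⟩
  obtain ⟨z, hz⟩ : ∃ z, C.proj A z ≠ 0 := by
    by_contra! h0
    exact hne (ContinuousLinearMap.ext h0)
  obtain ⟨k, -, hk⟩ := hcon A hA (C.proj A z) (C.proj_idem hA z) Set.univ (by
    rw [g.diag_univ, hU.unitary.adjoint.norm_map]
    have := norm_pos_iff.2 hz
    linarith)
  have hm := LFCMSpace.fatten_mem (𝒳 := 𝒳) E A
  set w := ContinuousLinearMap.adjoint U (g.basis k) with hw
  have hwn : ‖w‖ = 1 := by rw [hw, hU.unitary.norm_map, g.basis.orthonormal.1]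
  have h1 : ‖w‖ ≤ ‖C.proj (𝒳.fatten E A) w‖ + ‖C.proj (𝒳.fatten E A)ᶜ w‖ := by
    conv_lhs => rw [← C.proj_add_compl hm w]
    exact norm_add_le _ _
  have h2 : δ < ‖C.proj (𝒳.fatten E A) w‖ := by linarith
  have hgm := 𝒴.isPartition.measurable (g.blk_mem k)
  have h3 : δ < ‖D.proj (g.blk k) ∘L U ∘L C.proj (𝒳.fatten E A)‖ := by
    rw [← norm_proj_adjoint hgm hm]
    refine h2.trans_le ?_
    have := (C.proj (𝒳.fatten E A) ∘L ContinuousLinearMap.adjoint U ∘L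
      D.proj (g.blk k)).le_opNorm (g.basis k)
    rw [g.basis.orthonormal.1, mul_one] at this
    refine le_of_eq_of_le ?_ this
    simp only [ContinuousLinearMap.comp_apply, g.proj_blk, hw]
  obtain ⟨y, hy⟩ := 𝒴.isPartition.nonempty _ (g.blk_mem k)
  obtain ⟨x, hx⟩ : (𝒳.fatten E A).Nonempty := by
    rw [Set.nonempty_iff_ne_empty]
    intro h0
    rw [h0, Set.compl_empty, C.proj_univ] at hk
    rw [h0, C.proj_empty] at h2
    simp only [zero_apply, norm_zero] at h2
    linarith
  have hnear : ∀ x ∈ 𝒳.fatten E A, ∃ a ∈ A, (x, a) ∈ RelComp 𝒳.disc E := by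
    intro x hx
    obtain ⟨z, hxz, a, ha, hza⟩ := LFCMSpace.mem_fatten.1 hx
    exact ⟨a, ha, z, hxz, hza⟩
  refine ⟨y, x, ⟨_, ⟨g.blk k, 𝒳.fatten E A, rfl, hgm, LFCMSpace.block_prod_subset (g.blk_mem k),
    hm, ?_, h3⟩, hy, hx⟩, hnear x hx⟩
  rintro ⟨p, q⟩ ⟨hp, hq⟩
  obtain ⟨a, ha, hpa⟩ := hnear p hp
  obtain ⟨a', ha', hqa⟩ := hnear q hq
  exact ⟨a, hpa, a', hAd ⟨ha, ha'⟩, hqa⟩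

/-- Approximate relations of `U` are densely defined if the domain is a faithful module. -/
theorem ConjApprox.exists_mem_approxRel_of_faithful
    (hU : ConjApprox D C (ContinuousLinearMap.adjoint U))
    (hX : 𝒳.coarse.IsCountablyGenerated) (hC : IsFaithfulMod 𝒳 C) {δ : ℝ}
    (hδ0 : 0 < δ) (hδ1 : δ < 1) :
    ∃ E₀ ∈ 𝒳.coarse.entourages, ∃ E₁ ∈ 𝒳.coarse.entourages, ∀ x : X,
      ∃ y x', (y, x') ∈ approxRel 𝒳 𝒴 C.proj D.proj U δ 𝒴.disc E₀ ∧ (x', x) ∈ E₁ := by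
  obtain ⟨E₀, hE₀, E₁, hE₁, h⟩ := hU.exists_mem_approxRel (U := U) hX hδ0 hδ1
  obtain ⟨-, E, hE, hsub⟩ := hC
  refine ⟨E₀, hE₀, _, 𝒳.coarse.comp_mem hE₁ (𝒳.coarse.comp_mem 𝒳.disc_mem
    (𝒳.coarse.transpose_mem hE)), fun x => ?_⟩
  obtain ⟨a, ⟨A, ⟨hA, hAd, hrank⟩, haA⟩, hxa⟩ := hsub (Set.mem_univ x)
  have hne : C.proj A ≠ 0 := by
    intro h0
    rw [projRank, h0] at hrank
    have : LinearMap.rank ((0 : H₁ →L[ℂ] H₁) : H₁ →ₗ[ℂ] H₁) = 0 := LinearMap.rank_zero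
    rw [this] at hrank
    exact absurd hrank (by simp)
  obtain ⟨y, x', hyx, a', ha', hxa'⟩ := h A hA hAd hne
  exact ⟨y, x', hyx, a', hxa', a, hAd ⟨ha', haA⟩, hxa⟩

end Control

/-! ## Existence of implementing unitaries -/

theorem HilbertBasis.clm_ext {ι E E' : Type} [NormedAddCommGroup E] [InnerProductSpace ℂ E]
    [NormedAddCommGroup E'] [NormedSpace ℂ E'] (b : HilbertBasis ι ℂ E) {s t : E →L[ℂ] E'}
    (h : ∀ i, s (b i) = t (b i)) : s = t := by
  refine ContinuousLinearMap.ext_on (Submodule.dense_iff_topologicalClosure_eq_top.2 b.dense_span) ?_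
  rintro _ ⟨i, rfl⟩
  exact h i

theorem HilbertBasis.ext_inner {ι E : Type} [NormedAddCommGroup E] [InnerProductSpace ℂ E]
    (b : HilbertBasis ι ℂ E) {x y : E} (h : ∀ i, inner ℂ (b i) x = inner ℂ (b i) y) : x = y :=
  b.repr.injective (lp.ext (funext fun i => by rw [b.repr_apply_apply, b.repr_apply_apply, h]))

theorem AdaptedBasis.approximable_rankOne_self [NormedAddCommGroup H₁] [InnerProductSpace ℂ H₁]
    [CompleteSpace H₁] {𝒳 : LFCMSpace X} {C : CoarseModule 𝒳 H₁} (b : AdaptedBasis C) (i : b.ι) :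
    Approximable 𝒳 C.proj C.proj (InnerProductSpace.rankOne ℂ (b.basis i) (b.basis i)) := by
  classical
  convert b.approximable_diag {i} using 1
  ext x
  refine (b.hasSum_diag {i} x).unique ?_ |>.symm
  convert hasSum_ite_eq i (InnerProductSpace.rankOne ℂ (b.basis i) (b.basis i) x) using 2 with j
  by_cases h : j = i
  · subst h
    rw [if_pos rfl, if_pos (Set.mem_singleton j)]
    rfl
  · rw [if_neg h, if_neg (by simpa using h)]

namespace StarFunctor

variable {𝒳 : LFCMSpace X} {𝒴 : LFCMSpace Y} (F : StarFunctor 𝒳 𝒴)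

theorem map_congr {C D : BundledModule 𝒳} {t s : C.H →L[ℂ] D.H} (h : t = s)
    (ht : Approximable 𝒳 C.mod.proj D.mod.proj t) (hs : Approximable 𝒳 C.mod.proj D.mod.proj s) :
    F.map t ht = F.map s hs := by
  subst h
  rfl

theorem map_zero {C D : BundledModule 𝒳}
    (h : Approximable 𝒳 C.mod.proj D.mod.proj (0 : C.H →L[ℂ] D.H)) : F.map 0 h = 0 := by
  have h' := h.smul 0
  rw [← zero_smul ℂ (F.map 0 h), ← F.map_smul 0 0 h h']
  exact F.map_congr (zero_smul ℂ _).symm _ _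

variable {F}

theorem Faithful.map_ne_zero (hF : F.Faithful) {C D : BundledModule 𝒳} {t : C.H →L[ℂ] D.H}
    (ht : Approximable 𝒳 C.mod.proj D.mod.proj t) (h : t ≠ 0) : F.map t ht ≠ 0 := by
  intro h0
  have hz : Approximable 𝒳 C.mod.proj D.mod.proj (0 : C.H →L[ℂ] D.H) := by
    simpa using ht.smul 0
  exact h (hF C D t 0 ht hz (h0.trans (F.map_zero hz).symm))

theorem inner_map_rankOne {C : BundledModule 𝒳} {a b e e' : C.H}
    (ha : Approximable 𝒳 C.mod.proj C.mod.proj (InnerProductSpace.rankOne ℂ a e))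
    (hb : Approximable 𝒳 C.mod.proj C.mod.proj (InnerProductSpace.rankOne ℂ b e'))
    (hab : Approximable 𝒳 C.mod.proj C.mod.proj
      ((inner ℂ a b : ℂ) • InnerProductSpace.rankOne ℂ e e')) (w w' : (F.obj C).H) :
    inner ℂ (F.map _ ha w) (F.map _ hb w') = inner ℂ w (F.map _ hab w') := by
  rw [← ContinuousLinearMap.adjoint_inner_right, ← F.map_star _ ha ha.adjoint,
    ← ContinuousLinearMap.comp_apply, ← F.map_comp _ _ hb ha.adjoint (ha.adjoint.comp hb)]
  congr 2
  refine F.map_congr ?_ _ _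
  rw [InnerProductSpace.adjoint_rankOne, InnerProductSpace.rankOne_comp_rankOne]

/-- The isomorphism of endomorphism algebras induced by a full and faithful *-functor is
implemented by a unitary. -/
theorem exists_implements (hfull : F.Full) (hfaith : F.Faithful) (C : BundledModule 𝒳) :
    ∃ U, F.Implements C U := by
  classical
  obtain ⟨b⟩ := AdaptedBasis.nonempty C.mod
  obtain ⟨d⟩ := AdaptedBasis.nonempty (F.obj C).mod
  let e := b.basis
  have he : Orthonormal ℂ e := b.basis.orthonormal
  let ap : C.H → C.H → Prop := fun v v' =>
    Approximable 𝒳 C.mod.proj C.mod.proj (InnerProductSpace.rankOne ℂ v v')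
  have ap_symm : ∀ {v v'}, ap v v' → ap v' v := by
    intro v v' h
    have := h.adjoint
    rwa [InnerProductSpace.adjoint_rankOne] at this
  have ap_trans : ∀ {v k v'}, ap v (e k) → ap (e k) v' → ap v v' := by
    intro v k v' h h'
    have := h.comp h'
    rwa [InnerProductSpace.rankOne_comp_rankOne, inner_self_eq_norm_sq_to_K, he.1,
      RCLike.ofReal_one, one_pow, one_smul] at this
  let s : Setoid b.ι := ⟨fun k l => ap (e k) (e l),
    ⟨fun k => b.approximable_rankOne_self k, ap_symm, ap_trans⟩⟩
  let c : b.ι → b.ι := fun k => (Quotient.mk s k).out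
  have hc : ∀ k, ap (e k) (e (c k)) := fun k => ap_symm (Quotient.mk_out (s := s) k)
  have hcc : ∀ {k l}, ap (e k) (e l) → c k = c l := fun h =>
    congrArg Quotient.out (Quotient.sound (s := s) h)
  have hW : ∀ k, ∃ w, ‖w‖ = 1 ∧ F.map _ (b.approximable_rankOne_self k) w = w := by
    intro k
    have hek : e k ≠ 0 := he.ne_zero k
    have hne := hfaith.map_ne_zero (b.approximable_rankOne_self k)
      (InnerProductSpace.rankOne_ne_zero hek hek)
    obtain ⟨z, hz⟩ : ∃ z, F.map _ (b.approximable_rankOne_self k) z ≠ 0 := by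
      by_contra! h0
      exact hne (ContinuousLinearMap.ext h0)
    refine ⟨(‖F.map _ (b.approximable_rankOne_self k) z‖⁻¹ : ℂ) •
      F.map _ (b.approximable_rankOne_self k) z, ?_, ?_⟩
    · rw [norm_smul, norm_inv, Complex.norm_real, norm_norm, inv_mul_cancel₀ (norm_ne_zero_iff.2 hz)]
    · rw [_root_.map_smul, ← ContinuousLinearMap.comp_apply, ← F.map_comp _ _
        (b.approximable_rankOne_self k) (b.approximable_rankOne_self k)
        ((b.approximable_rankOne_self k).comp (b.approximable_rankOne_self k))]
      congr 2
      refine F.map_congr ?_ _ _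
      exact InnerProductSpace.isIdempotentElem_rankOne_self (he.1 k)
  choose W hW1 hWp using hW
  let G : ∀ k v, ap v (e (c k)) → (F.obj C).H := fun k v h => F.map _ h (W (c k))
  have hG_inner : ∀ k l v v' (h : ap v (e (c k))) (h' : ap v' (e (c l))),
      c k = c l ∨ inner ℂ v v' = 0 → inner ℂ (G k v h) (G l v' h') = inner ℂ v v' := by
    intro k l v v' h h' hor
    have key : ∀ m n (h : ap v (e m)) (h' : ap v' (e n)), m = n ∨ inner ℂ v v' = 0 →
        inner ℂ (F.map _ h (W m)) (F.map _ h' (W n)) = inner ℂ v v' := by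
      intro m n h h' hor
      rcases hor with rfl | h0
      · have hap := (b.approximable_rankOne_self m).smul (inner ℂ v v')
        rw [inner_map_rankOne h h' hap, F.map_smul _ _ (b.approximable_rankOne_self m),
          smul_apply, inner_smul_right, hWp, inner_self_eq_norm_sq_to_K, hW1]
        simp
      · have hz : (inner ℂ v v' : ℂ) • InnerProductSpace.rankOne ℂ (e m) (e n) = 0 := by
          rw [h0, zero_smul]
        have hz0 : Approximable 𝒳 C.mod.proj C.mod.proj (0 : C.H →L[ℂ] C.H) := by
          simpa using (b.approximable_rankOne_self m).smul 0
        rw [inner_map_rankOne h h' (hz ▸ hz0), F.map_congr hz _ hz0, F.map_zero, h0,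
          zero_apply, inner_zero_right]
    exact key _ _ h h' hor
  have hG_map : ∀ k v (h : ap v (e (c k))) (t : C.H →L[ℂ] C.H)
      (ht : Approximable 𝒳 C.mod.proj C.mod.proj t),
      ∃ h' : ap (t v) (e (c k)), F.map t ht (G k v h) = G k (t v) h' := by
    intro k v h t ht
    have hcomp := InnerProductSpace.comp_rankOne (𝕜 := ℂ) v (e (c k)) t
    have h' : ap (t v) (e (c k)) := by
      have := ht.comp h
      rwa [hcomp] at this
    refine ⟨h', ?_⟩
    change F.map t ht (F.map _ h (W (c k))) = F.map _ h' (W (c k))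
    rw [← ContinuousLinearMap.comp_apply, ← F.map_comp _ _ h ht (ht.comp h)]
    exact congrArg (fun s : _ →L[ℂ] _ => s (W (c k))) (F.map_congr hcomp _ _)
  have hg : Orthonormal ℂ fun k => G k (e k) (hc k) := by
    rw [orthonormal_iff_ite]
    intro k l
    rw [hG_inner, orthonormal_iff_ite.1 he]
    by_cases hkl : k = l
    · exact Or.inl (hkl ▸ rfl)
    · exact Or.inr (he.2 hkl)
  let U : C.H →L[ℂ] (F.obj C).H := partialIsom he hg
  have hUe : ∀ k, U (e k) = G k (e k) (hc k) := partialIsom_apply_self he hg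
  have hU1 : ContinuousLinearMap.adjoint U ∘L U = ContinuousLinearMap.id ℂ C.H := by
    refine b.basis.clm_ext fun k => b.basis.ext_inner fun l => ?_
    rw [ContinuousLinearMap.comp_apply, ContinuousLinearMap.adjoint_inner_right]
    change inner ℂ (U (e l)) (U (e k)) = inner ℂ (e l) (e k)
    rw [hUe, hUe, orthonormal_iff_ite.1 hg, orthonormal_iff_ite.1 he]
  have hUG : ∀ k v (h : ap v (e (c k))), U v = G k v h := by
    intro k v h
    have h1 : ContinuousLinearMap.adjoint U (G k v h) = v := by
      refine b.basis.ext_inner fun l => ?_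
      rw [ContinuousLinearMap.adjoint_inner_right]
      change inner ℂ (U (e l)) _ = inner ℂ (e l) v
      rw [hUe]
      refine hG_inner _ _ _ _ _ _ ?_
      by_cases h0 : inner ℂ (e l) v = 0
      · exact Or.inr h0
      · left
        have h2 : ap (e l) (e (c k)) := by
          have := ((b.approximable_rankOne_self l).comp h).smul (inner ℂ (e l) v)⁻¹
          rwa [InnerProductSpace.rankOne_comp_rankOne, inv_smul_smul₀ h0] at this
        exact hcc (ap_trans h2 (ap_symm (hc k)))
    have h2 : inner ℂ (G k v h) (U v) = inner ℂ v v := by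
      rw [← ContinuousLinearMap.adjoint_inner_left, h1]
    have h3 : inner ℂ (U v) (U v) = inner ℂ v v := by
      rw [← ContinuousLinearMap.adjoint_inner_right]
      exact congrArg (inner ℂ v) (congrArg (fun s : C.H →L[ℂ] C.H => s v) hU1)
    have h4 : inner ℂ (U v) (G k v h) = inner ℂ v v := by
      rw [← ContinuousLinearMap.adjoint_inner_right, h1]
    have h5 := hG_inner k k v v h h (Or.inl rfl)
    rw [← sub_eq_zero, ← inner_self_eq_zero (𝕜 := ℂ), inner_sub_left, inner_sub_right,
      inner_sub_right, h2, h3, h4, h5]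
    ring
  have hinter : ∀ (t : C.H →L[ℂ] C.H) (ht : Approximable 𝒳 C.mod.proj C.mod.proj t),
      F.map t ht ∘L U = U ∘L t := by
    intro t ht
    refine b.basis.clm_ext fun k => ?_
    change F.map t ht (U (e k)) = U (t (e k))
    obtain ⟨h', h⟩ := hG_map k (e k) (hc k) t ht
    rw [hUe, h, hUG k _ h']
  have hU2 : U ∘L ContinuousLinearMap.adjoint U = ContinuousLinearMap.id ℂ (F.obj C).H := by
    refine d.basis.clm_ext fun j => ?_
    obtain ⟨p, hp, hFp⟩ := hfull C C _ (d.approximable_rankOne_self j)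
    have hp0 : p ≠ 0 := by
      rintro rfl
      rw [F.map_zero] at hFp
      exact InnerProductSpace.rankOne_ne_zero (d.basis.orthonormal.ne_zero j)
        (d.basis.orthonormal.ne_zero j) hFp.symm
    obtain ⟨k, hk⟩ : ∃ k, p (e k) ≠ 0 := by
      by_contra! h0
      exact hp0 (b.basis.clm_ext h0)
    have h1 : (inner ℂ (d.basis j) (U (e k)) : ℂ) • d.basis j = U (p (e k)) := by
      have := congrArg (fun s : C.H →L[ℂ] (F.obj C).H => s (e k)) (hinter p hp)
      rw [hFp] at this
      exact this
    have h2 : (inner ℂ (d.basis j) (U (e k)) : ℂ) ≠ 0 := by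
      intro h0
      rw [h0, zero_smul] at h1
      have h3 := congrArg (fun s : C.H →L[ℂ] C.H => s (p (e k))) hU1
      change ContinuousLinearMap.adjoint U (U (p (e k))) = p (e k) at h3
      rw [← h1, _root_.map_zero] at h3
      exact hk h3.symm
    have h3 : d.basis j = U ((inner ℂ (d.basis j) (U (e k)) : ℂ)⁻¹ • p (e k)) := by
      rw [_root_.map_smul, ← h1, inv_smul_smul₀ h2]
    change U (ContinuousLinearMap.adjoint U (d.basis j)) = d.basis j
    rw [h3]
    exact congrArg U (congrArg (fun s : C.H →L[ℂ] C.H => s _) hU1)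
  refine ⟨U, ⟨hU1, hU2⟩, fun t ht => ?_⟩
  rw [← ContinuousLinearMap.comp_assoc, ← hinter t ht, ContinuousLinearMap.comp_assoc, hU2,
    ContinuousLinearMap.comp_id]

theorem Implements.conjApprox {C : BundledModule 𝒳} {U : C.H →L[ℂ] (F.obj C).H}
    (hU : F.Implements C U) : ConjApprox C.mod (F.obj C).mod U :=
  ⟨hU.1, fun t ht => hU.2 t ht ▸ F.map_approximable t ht⟩

theorem Implements.conjApprox_adjoint (hfull : F.Full) {C : BundledModule 𝒳}
    {U : C.H →L[ℂ] (F.obj C).H} (hU : F.Implements C U) :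
    ConjApprox (F.obj C).mod C.mod (ContinuousLinearMap.adjoint U) := by
  refine ⟨hU.1.adjoint, fun s hs => ?_⟩
  obtain ⟨t, ht, rfl⟩ := hfull C C s hs
  convert ht using 1
  ext x
  simp only [hU.2 t ht, ContinuousLinearMap.comp_apply, ContinuousLinearMap.adjoint_adjoint,
    hU.1.adjoint_apply]

end StarFunctor

/-! ## Direct sums and transfer of faithfulness -/

theorem isFaithfulMod_iff [NormedAddCommGroup H₁] [InnerProductSpace ℂ H₁] [CompleteSpace H₁]
    {𝒳 : LFCMSpace X} {C : CoarseModule 𝒳 H₁} :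
    IsFaithfulMod 𝒳 C ↔ ∃ E ∈ 𝒳.coarse.entourages, ∀ x, ∃ A ∈ 𝒳.meas, A ×ˢ A ⊆ 𝒳.disc ∧
      C.proj A ≠ 0 ∧ ∃ a ∈ A, (x, a) ∈ E := by
  have hrank : ∀ p : H₁ →L[ℂ] H₁, 1 ≤ projRank p ↔ p ≠ 0 := by
    intro p
    rw [projRank, Cardinal.one_le_iff_ne_zero, Ne, LinearMap.rank, rank_zero_iff,
      Submodule.subsingleton_iff_eq_bot, LinearMap.range_eq_bot, not_iff_not]
    exact ⟨fun h => ContinuousLinearMap.ext fun x => congrArg (fun s : H₁ →ₗ[ℂ] H₁ => s x) h,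
      fun h => by rw [h]; rfl⟩
  constructor
  · rintro ⟨-, E, hE, h⟩
    refine ⟨E, hE, fun x => ?_⟩
    obtain ⟨a, ⟨A, ⟨hA, hAd, hr⟩, ha⟩, hxa⟩ := h (Set.mem_univ x)
    exact ⟨A, hA, hAd, (hrank _).1 hr, a, ha, hxa⟩
  · rintro ⟨E, hE, h⟩
    refine ⟨⟨_, 𝒳.coarse.diagonal_mem, fun x _ => ⟨x, Set.mem_univ x, rfl⟩⟩, E, hE, fun x _ => ?_⟩
    obtain ⟨A, hA, hAd, hr, a, ha, hxa⟩ := h x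
    exact ⟨a, ⟨A, ⟨hA, hAd, (hrank _).2 hr⟩, ha⟩, hxa⟩

/-- A module receiving a left invertible approximable map from a faithful module is faithful. -/
theorem IsFaithfulMod.of_leftInverse [NormedAddCommGroup H₁] [InnerProductSpace ℂ H₁]
    [CompleteSpace H₁] [NormedAddCommGroup H₂] [InnerProductSpace ℂ H₂] [CompleteSpace H₂]
    {𝒳 : LFCMSpace X} {C : CoarseModule 𝒳 H₁} {D : CoarseModule 𝒳 H₂} (hC : IsFaithfulMod 𝒳 C)
    {v : H₁ →L[ℂ] H₂} (hv : Approximable 𝒳 C.proj D.proj v) {u : H₂ →L[ℂ] H₁}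
    (huv : u ∘L v = ContinuousLinearMap.id ℂ H₁) : IsFaithfulMod 𝒳 D := by
  obtain ⟨E, hE, h⟩ := isFaithfulMod_iff.1 hC
  obtain ⟨E', hE', s, hs, hle⟩ := hv.exists_blockSupp (ε := 1 / (2 * (‖u‖ + 1))) (by positivity)
  refine isFaithfulMod_iff.2 ⟨_, 𝒳.coarse.comp_mem hE (𝒳.coarse.comp_mem 𝒳.disc_mem
    (𝒳.coarse.transpose_mem hE')), fun x => ?_⟩
  obtain ⟨A, hA, hAd, hne, a, ha, hxa⟩ := h x
  obtain ⟨z, hz⟩ : ∃ z, C.proj A z ≠ 0 := by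
    by_contra! h0
    exact hne (ContinuousLinearMap.ext h0)
  have hsz : s (C.proj A z) ≠ 0 := by
    intro h0
    set w := C.proj A z with hw
    have h1 : ‖w‖ ≤ ‖u‖ * ‖v w‖ := by
      conv_lhs => rw [← show u (v w) = w from congrArg (fun r : H₁ →L[ℂ] H₁ => r w) huv]
      exact u.le_opNorm _
    have h2 : ‖v w‖ ≤ 1 / (2 * (‖u‖ + 1)) * ‖w‖ := by
      have := (v - s).le_of_opNorm_le hle w
      rwa [sub_apply, h0, sub_zero] at this
    have h3 : ‖u‖ * (1 / (2 * (‖u‖ + 1))) ≤ 1 / 2 := by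
      have := norm_nonneg u
      rw [mul_one_div, div_le_div_iff₀ (by positivity) (by norm_num)]
      linarith
    have h4 : 0 < ‖w‖ := norm_pos_iff.2 hz
    have h5 : ‖u‖ * ‖v w‖ ≤ ‖u‖ * (1 / (2 * (‖u‖ + 1)) * ‖w‖) := by gcongr
    nlinarith
  obtain ⟨Q, hQ, hQs⟩ : ∃ Q ∈ 𝒳.partition, s (C.proj Q (C.proj A z)) ≠ 0 := by
    by_contra! h0
    exact hsz (C.eq_zero_of_blocks s _ h0)
  obtain ⟨Q', hQ', hQs'⟩ : ∃ Q' ∈ 𝒳.partition, D.proj Q' (s (C.proj Q (C.proj A z))) ≠ 0 := by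
    by_contra! h0
    exact hQs (D.eq_zero_of_proj_blocks h0)
  obtain ⟨q, hqQ, hqA⟩ : (Q ∩ A).Nonempty := by
    rw [← Set.not_disjoint_iff_nonempty_inter]
    intro hd
    rw [C.proj_of_disjoint (𝒳.isPartition.measurable hQ) hA hd, map_zero] at hQs
    exact hQs rfl
  obtain ⟨q', hq'⟩ := 𝒳.isPartition.nonempty _ hQ'
  refine ⟨Q', 𝒳.isPartition.measurable hQ', LFCMSpace.block_prod_subset hQ', ?_, q', hq',
    a, hxa, q, hAd ⟨ha, hqA⟩, hs Q' hQ' Q hQ _ hQs' ⟨hq', hqQ⟩⟩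
  intro h0
  rw [h0] at hQs'
  exact hQs' rfl

section DirectSum

variable [NormedAddCommGroup H₀] [InnerProductSpace ℂ H₀] [CompleteSpace H₀]
variable [NormedAddCommGroup H₁] [InnerProductSpace ℂ H₁] [CompleteSpace H₁]
variable {𝒳 : LFCMSpace X}

theorem exists_isDirectSum (C₀ : CoarseModule 𝒳 H₀) (C₁ : CoarseModule 𝒳 H₁) :
    ∃ M, IsDirectSum 𝒳 C₀ C₁ M := by
  refine ⟨⟨fun A => prodOp (C₀.proj A) (C₁.proj A), ?_, ?_, ?_, ?_, ?_⟩, fun A => rfl⟩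
  · ext x
    simp [prodOp, C₀.proj_empty, C₁.proj_empty]
    rfl
  · intro A hA
    rw [ContinuousLinearMap.isSelfAdjoint_iff_isSymmetric]
    intro x y
    have h₀ := ContinuousLinearMap.isSelfAdjoint_iff_isSymmetric.1 (C₀.proj_selfAdjoint A hA)
    have h₁ := ContinuousLinearMap.isSelfAdjoint_iff_isSymmetric.1 (C₁.proj_selfAdjoint A hA)
    rw [WithLp.prod_inner_apply, WithLp.prod_inner_apply]
    exact congrArg₂ (· + ·) (h₀ x.fst y.fst) (h₁ x.snd y.snd)
  · intro A B hA hB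
    rw [C₀.proj_inter hA hB, C₁.proj_inter hA hB]
    rfl
  · intro A B hA hB hAB
    rw [C₀.proj_union hA hB hAB, C₁.proj_union hA hB hAB]
    rfl
  · rw [Submodule.dense_iff_topologicalClosure_eq_top, eq_top_iff]
    set K := (Submodule.span ℂ (⋃ A ∈ {A | A ∈ 𝒳.meas ∧ 𝒳.coarse.IsBounded A},
      Set.range (prodOp (C₀.proj A) (C₁.proj A)))).topologicalClosure with hK
    have hKcl : IsClosed (K : Set (WithLp 2 (H₀ × H₁))) := Submodule.isClosed_topologicalClosure _
    have hmem : ∀ A ∈ 𝒳.meas, 𝒳.coarse.IsBounded A → ∀ z,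
        prodOp (C₀.proj A) (C₁.proj A) z ∈ K := fun A hA hAb z =>
      Submodule.le_topologicalClosure _ (Submodule.subset_span
        (Set.mem_biUnion (show A ∈ {A | A ∈ 𝒳.meas ∧ 𝒳.coarse.IsBounded A} from ⟨hA, hAb⟩) ⟨z, rfl⟩))
    have h₀ : ∀ z, inlOp H₀ H₁ z ∈ K := by
      have hsub : Submodule.span ℂ (⋃ A ∈ {A | A ∈ 𝒳.meas ∧ 𝒳.coarse.IsBounded A},
          Set.range (C₀.proj A)) ≤ K.comap (inlOp H₀ H₁ : H₀ →ₗ[ℂ] WithLp 2 (H₀ × H₁)) := by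
        rw [Submodule.span_le]
        refine Set.iUnion₂_subset ?_
        rintro A ⟨hA, hAb⟩ _ ⟨z, rfl⟩
        have := hmem A hA hAb (inlOp H₀ H₁ z)
        rwa [← ContinuousLinearMap.comp_apply, prodOp_comp_inlOp] at this
      intro z
      exact closure_minimal hsub (hKcl.preimage (inlOp H₀ H₁).continuous) (C₀.nondeg z)
    have h₁ : ∀ z, inrOp H₀ H₁ z ∈ K := by
      have hsub : Submodule.span ℂ (⋃ A ∈ {A | A ∈ 𝒳.meas ∧ 𝒳.coarse.IsBounded A},
          Set.range (C₁.proj A)) ≤ K.comap (inrOp H₀ H₁ : H₁ →ₗ[ℂ] WithLp 2 (H₀ × H₁)) := by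
        rw [Submodule.span_le]
        refine Set.iUnion₂_subset ?_
        rintro A ⟨hA, hAb⟩ _ ⟨z, rfl⟩
        have := hmem A hA hAb (inrOp H₀ H₁ z)
        rwa [← ContinuousLinearMap.comp_apply, prodOp_comp_inrOp] at this
      intro z
      exact closure_minimal hsub (hKcl.preimage (inrOp H₀ H₁).continuous) (C₁.nondeg z)
    intro z _
    have hz : z = inlOp H₀ H₁ z.fst + inrOp H₀ H₁ z.snd := by
      apply (WithLp.equiv 2 (H₀ × H₁)).injective
      exact Prod.ext (add_zero _).symm (zero_add _).symm
    rw [hz]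
    exact K.add_mem (h₀ _) (h₁ _)

theorem adjoint_inlOp_comp_inlOp : ContinuousLinearMap.adjoint (inlOp H₀ H₁) ∘L inlOp H₀ H₁ =
    ContinuousLinearMap.id ℂ H₀ := by
  ext x
  refine ext_inner_left ℂ fun w => ?_
  rw [ContinuousLinearMap.comp_apply, ContinuousLinearMap.adjoint_inner_right,
    WithLp.prod_inner_apply]
  simp [inlOp]

theorem adjoint_inrOp_comp_inrOp : ContinuousLinearMap.adjoint (inrOp H₀ H₁) ∘L inrOp H₀ H₁ =
    ContinuousLinearMap.id ℂ H₁ := by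
  ext x
  refine ext_inner_left ℂ fun w => ?_
  rw [ContinuousLinearMap.comp_apply, ContinuousLinearMap.adjoint_inner_right,
    WithLp.prod_inner_apply]
  simp [inrOp]

end DirectSum

/-! ## Comparison of implementing unitaries along isometries -/

section Isometry

variable [NormedAddCommGroup H₁] [InnerProductSpace ℂ H₁] [CompleteSpace H₁]
variable [NormedAddCommGroup H₂] [InnerProductSpace ℂ H₂] [CompleteSpace H₂]

theorem norm_apply_of_adjoint_comp_eq_id {v : H₁ →L[ℂ] H₂}
    (h : ContinuousLinearMap.adjoint v ∘L v = ContinuousLinearMap.id ℂ H₁) (x : H₁) :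
    ‖v x‖ = ‖x‖ :=
  v.norm_map_iff_adjoint_comp_self.2 h x

theorem norm_adjoint_apply_le_of_adjoint_comp_eq_id {v : H₁ →L[ℂ] H₂}
    (h : ContinuousLinearMap.adjoint v ∘L v = ContinuousLinearMap.id ℂ H₁) (y : H₂) :
    ‖ContinuousLinearMap.adjoint v y‖ ≤ ‖y‖ := by
  have h1 : ‖v‖ ≤ 1 := v.opNorm_le_bound zero_le_one fun x => by
    rw [norm_apply_of_adjoint_comp_eq_id h, one_mul]
  have h2 := (ContinuousLinearMap.adjoint v).le_opNorm y
  rw [LinearIsometryEquiv.norm_map] at h2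
  exact h2.trans (mul_le_of_le_one_left (norm_nonneg _) h1)

end Isometry

theorem approximable_proj [NormedAddCommGroup H₁] [InnerProductSpace ℂ H₁] [CompleteSpace H₁]
    {𝒳 : LFCMSpace X} (C : CoarseModule 𝒳 H₁) {A : Set X} (hA : A ∈ 𝒳.meas) :
    Approximable 𝒳 C.proj C.proj (C.proj A) := by
  refine approximable_of_blockSupp 𝒳.disc_mem fun Q' hQ' Q hQ x hx => ?_
  have h1 : C.proj Q' (C.proj A (C.proj Q x)) = C.proj A (C.proj Q' (C.proj Q x)) := by
    have hQm := 𝒳.isPartition.measurable hQ'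
    rw [C.proj_proj hQm hA, C.proj_proj hA hQm, Set.inter_comm]
  rw [h1] at hx
  exact BlockSupp.id C Q' hQ' Q hQ x fun h0 => hx (by
    rw [show C.proj Q' (C.proj Q x) = 0 from h0, map_zero])

namespace StarFunctor

variable {𝒳 : LFCMSpace X} {𝒴 : LFCMSpace Y} {F : StarFunctor 𝒳 𝒴}

theorem adjoint_map_comp_map {C M : BundledModule 𝒳} {v : C.H →L[ℂ] M.H}
    (hv : Approximable 𝒳 C.mod.proj M.mod.proj v)
    (h : ContinuousLinearMap.adjoint v ∘L v = ContinuousLinearMap.id ℂ C.H) :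
    ContinuousLinearMap.adjoint (F.map v hv) ∘L F.map v hv =
      ContinuousLinearMap.id ℂ (F.obj C).H := by
  rw [← F.map_star v hv hv.adjoint, ← F.map_comp v _ hv hv.adjoint (hv.adjoint.comp hv),
    F.map_congr h _ (Approximable.id _), F.map_id]

/-- The unitary of a module is, up to an isometry, a corner of the unitary of any larger module,
composed with a contraction commuting with approximable operators. -/
theorem Implements.exists_intertwiner {C M : BundledModule 𝒳} {v : C.H →L[ℂ] M.H}
    (hv : Approximable 𝒳 C.mod.proj M.mod.proj v)
    (hvv : ContinuousLinearMap.adjoint v ∘L v = ContinuousLinearMap.id ℂ C.H)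
    {U : C.H →L[ℂ] (F.obj C).H} (hU : F.Implements C U)
    {UM : M.H →L[ℂ] (F.obj M).H} (hUM : F.Implements M UM) :
    ∃ r : C.H →L[ℂ] C.H, (∀ x, ‖r x‖ ≤ ‖x‖) ∧ (∀ x, F.map v hv (U x) = UM (v (r x))) ∧
      ∀ t, Approximable 𝒳 C.mod.proj C.mod.proj t → ∀ x, r (t x) = t (r x) := by
  set V := F.map v hv with hV
  have hVV : ∀ x, ContinuousLinearMap.adjoint V (V x) = x := fun x =>
    congrArg (fun s : (F.obj C).H →L[ℂ] (F.obj C).H => s x) (adjoint_map_comp_map hv hvv)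
  have hvv' : ∀ x, ContinuousLinearMap.adjoint v (v x) = x := fun x =>
    congrArg (fun s : C.H →L[ℂ] C.H => s x) hvv
  have key : ∀ t (ht : Approximable 𝒳 C.mod.proj C.mod.proj t) w,
      V (F.map t ht (ContinuousLinearMap.adjoint V w)) =
        UM (v (t (ContinuousLinearMap.adjoint v (ContinuousLinearMap.adjoint UM w)))) := by
    intro t ht w
    have h1 := hUM.2 _ (hv.comp (ht.comp hv.adjoint))
    rw [F.map_comp _ _ (ht.comp hv.adjoint) hv, F.map_comp _ _ hv.adjoint ht,
      F.map_star v hv hv.adjoint] at h1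
    exact congrArg (fun s : (F.obj M).H →L[ℂ] (F.obj M).H => s w) h1
  refine ⟨ContinuousLinearMap.adjoint v ∘L ContinuousLinearMap.adjoint UM ∘L V ∘L U, ?_, ?_, ?_⟩
  · intro x
    refine (norm_adjoint_apply_le_of_adjoint_comp_eq_id hvv _).trans ?_
    refine (hUM.1.adjoint.norm_map _).le.trans ?_
    refine (norm_apply_of_adjoint_comp_eq_id (adjoint_map_comp_map hv hvv) _).le.trans ?_
    exact (hU.1.norm_map x).le
  · intro x
    have h1 := key _ (Approximable.id _) (V (U x))
    rw [F.map_id, hVV] at h1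
    exact h1
  · intro t ht x
    have h1 := key t ht (V (U x))
    rw [hVV, hU.2 t ht] at h1
    change V (U (t (ContinuousLinearMap.adjoint U (U x)))) = _ at h1
    rw [hU.1.adjoint_apply] at h1
    change ContinuousLinearMap.adjoint v (ContinuousLinearMap.adjoint UM (V (U (t x)))) =
      t (ContinuousLinearMap.adjoint v (ContinuousLinearMap.adjoint UM (V (U x))))
    rw [h1, hUM.1.adjoint_apply, hvv']

/-- Approximate relations of the unitary of a module are contained in approximate relations
of the unitary of any larger module. -/
theorem Implements.approxRel_subset {C M : BundledModule 𝒳} {v : C.H →L[ℂ] M.H}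
    (hv : Approximable 𝒳 C.mod.proj M.mod.proj v)
    (hvv : ContinuousLinearMap.adjoint v ∘L v = ContinuousLinearMap.id ℂ C.H)
    (hvp : ∀ A, M.mod.proj A ∘L v = v ∘L C.mod.proj A)
    {U : C.H →L[ℂ] (F.obj C).H} (hU : F.Implements C U)
    {UM : M.H →L[ℂ] (F.obj M).H} (hUM : F.Implements M UM) {δ : ℝ} (hδ : 0 < δ)
    {F' : Set (Y × Y)} (hF' : F' ∈ 𝒴.coarse.entourages) :
    ∃ F'' ∈ 𝒴.coarse.entourages, ∀ E,
      approxRel 𝒳 𝒴 C.mod.proj (F.obj C).mod.proj U δ F' E ⊆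
        approxRel 𝒳 𝒴 M.mod.proj (F.obj M).mod.proj UM (δ / 2) F'' E := by
  obtain ⟨r, hr, hrU, hrt⟩ := hU.exists_intertwiner hv hvv hUM
  set V := F.map v hv with hV
  have hVid := adjoint_map_comp_map (F := F) hv hvv
  obtain ⟨K, hK, hQ⟩ := (F.map_approximable v hv).adjoint.exists_quasiLocal (half_pos hδ)
  set G := RelTrans K ∪ {p : Y × Y | p.1 = p.2} with hG
  have hG' : RelComp 𝒴.disc G ∈ 𝒴.coarse.entourages := 𝒴.coarse.comp_mem 𝒴.disc_mem
    (𝒴.coarse.union_mem (𝒴.coarse.transpose_mem hK) 𝒴.coarse.diagonal_mem)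
  refine ⟨_, 𝒴.coarse.comp_mem hG' (𝒴.coarse.comp_mem hF' (𝒴.coarse.transpose_mem hG')),
    fun E => ?_⟩
  rintro ⟨y, x⟩ ⟨-, ⟨B, A, rfl, hB, hBF, hA, hAE, h⟩, hy, hx⟩
  have hm := LFCMSpace.fatten_mem (𝒳 := 𝒴) G B
  have hnear : ∀ y ∈ 𝒴.fatten G B, ∃ b ∈ B, (y, b) ∈ RelComp 𝒴.disc G := by
    intro y hy
    obtain ⟨z, hyz, b, hb, hzb⟩ := LFCMSpace.mem_fatten.1 hy
    exact ⟨b, hb, z, hyz, hzb⟩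
  have hself : ∀ y ∈ B, y ∈ 𝒴.fatten G B := fun y hy =>
    LFCMSpace.mem_fatten.2 ⟨y, 𝒴.disc_refl y, y, hy, Or.inr rfl⟩
  refine ⟨_, ⟨𝒴.fatten G B, A, rfl, hm, ?_, hA, hAE, ?_⟩, hself y hy, hx⟩
  · rintro ⟨p, q⟩ ⟨hp, hq⟩
    obtain ⟨b, hb, hpb⟩ := hnear p hp
    obtain ⟨b', hb', hqb⟩ := hnear q hq
    exact ⟨b, hpb, b', hBF ⟨hb, hb'⟩, hqb⟩
  · obtain ⟨z, hz⟩ := exists_lt_norm_apply hδ.le h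
    change δ * ‖z‖ < ‖(F.obj C).mod.proj B (U (C.mod.proj A z))‖ at hz
    set w := V (U (C.mod.proj A z)) with hw
    have hVw : ContinuousLinearMap.adjoint V w = U (C.mod.proj A z) :=
      congrArg (fun s : (F.obj C).H →L[ℂ] (F.obj C).H => s (U (C.mod.proj A z))) hVid
    have hwn : ‖w‖ ≤ ‖z‖ := by
      rw [hw, norm_apply_of_adjoint_comp_eq_id hVid, hU.1.norm_map]
      exact C.mod.norm_proj_le hA z
    have h1 : U (C.mod.proj A z) =
        ContinuousLinearMap.adjoint V ((F.obj M).mod.proj (𝒴.fatten G B) w) +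
          ContinuousLinearMap.adjoint V ((F.obj M).mod.proj (𝒴.fatten G B)ᶜ w) := by
      rw [← _root_.map_add, (F.obj M).mod.proj_add_compl hm, hVw]
    have h2 : ‖(F.obj C).mod.proj B (ContinuousLinearMap.adjoint V
        ((F.obj M).mod.proj (𝒴.fatten G B)ᶜ w))‖ ≤ δ / 2 * ‖w‖ := by
      refine hQ B hB _ (𝒴.compl_mem hm) (fun y hy x hx hyx => hx ?_) w
      exact LFCMSpace.mem_fatten.2 ⟨x, 𝒴.disc_refl x, y, hy, Or.inl hyx⟩
    have h3 : ‖(F.obj C).mod.proj B (ContinuousLinearMap.adjoint V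
        ((F.obj M).mod.proj (𝒴.fatten G B) w))‖ ≤ ‖(F.obj M).mod.proj (𝒴.fatten G B) w‖ :=
      ((F.obj C).mod.norm_proj_le hB _).trans
        (norm_adjoint_apply_le_of_adjoint_comp_eq_id hVid _)
    have h4 : ‖(F.obj M).mod.proj (𝒴.fatten G B) w‖ ≤
        ‖(F.obj M).mod.proj (𝒴.fatten G B) ∘L UM ∘L M.mod.proj A‖ * ‖z‖ := by
      have h5 : w = UM (M.mod.proj A (v (r z))) := by
        rw [hw, hrU, hrt _ (approximable_proj C.mod hA)]
        exact congrArg UM (congrArg (fun s : C.H →L[ℂ] M.H => s (r z)) (hvp A)).symm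
      rw [h5]
      refine (((F.obj M).mod.proj (𝒴.fatten G B) ∘L UM ∘L M.mod.proj A).le_opNorm _).trans ?_
      gcongr
      rw [norm_apply_of_adjoint_comp_eq_id hvv]
      exact hr z
    rw [h1, _root_.map_add] at hz
    have h6 := norm_add_le ((F.obj C).mod.proj B (ContinuousLinearMap.adjoint V
      ((F.obj M).mod.proj (𝒴.fatten G B) w))) ((F.obj C).mod.proj B
      (ContinuousLinearMap.adjoint V ((F.obj M).mod.proj (𝒴.fatten G B)ᶜ w)))
    by_contra! hcon
    have h7 : ‖(F.obj M).mod.proj (𝒴.fatten G B) ∘L UM ∘L M.mod.proj A‖ * ‖z‖ ≤ δ / 2 * ‖z‖ := by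
      gcongr
    have h8 : δ / 2 * ‖w‖ ≤ δ / 2 * ‖z‖ := by gcongr
    linarith

/-- Approximate relations of two modules are contained in common approximate relations of
their direct sum. -/
theorem exists_approxRel_union_subset (hfull : F.Full) (hfaith : F.Faithful)
    {C₀ C₁ : BundledModule 𝒳} {U₀ : C₀.H →L[ℂ] (F.obj C₀).H} (hU₀ : F.Implements C₀ U₀)
    {U₁ : C₁.H →L[ℂ] (F.obj C₁).H} (hU₁ : F.Implements C₁ U₁) {δ₀ δ₁ : ℝ}
    (hδ₀ : 0 < δ₀) (hδ₁ : 0 < δ₁) {F₀ F₁ : Set (Y × Y)} (hF₀ : F₀ ∈ 𝒴.coarse.entourages)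
    (hF₁ : F₁ ∈ 𝒴.coarse.entourages) {E₀ E₁ : Set (X × X)} (hE₀ : E₀ ∈ 𝒳.coarse.entourages)
    (hE₁ : E₁ ∈ 𝒳.coarse.entourages) :
    ∃ (M : BundledModule 𝒳) (U : M.H →L[ℂ] (F.obj M).H), F.Implements M U ∧ ∃ δ > 0,
      ∃ F' ∈ 𝒴.coarse.entourages, ∃ E ∈ 𝒳.coarse.entourages,
        approxRel 𝒳 𝒴 C₀.mod.proj (F.obj C₀).mod.proj U₀ δ₀ F₀ E₀ ⊆
          approxRel 𝒳 𝒴 M.mod.proj (F.obj M).mod.proj U δ F' E ∧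
        approxRel 𝒳 𝒴 C₁.mod.proj (F.obj C₁).mod.proj U₁ δ₁ F₁ E₁ ⊆
          approxRel 𝒳 𝒴 M.mod.proj (F.obj M).mod.proj U δ F' E := by
  obtain ⟨M', hM⟩ := exists_isDirectSum C₀.mod C₁.mod
  set M : BundledModule 𝒳 := BundledModule.ofModule M' with hMdef
  obtain ⟨U, hU⟩ := exists_implements hfull hfaith M
  obtain ⟨F₂, hF₂, h₀⟩ := hU₀.approxRel_subset (M := M) (v := inlOp C₀.H C₁.H)
    hM.approximable_inl adjoint_inlOp_comp_inlOp
    (fun A => by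
      change M'.proj A ∘L _ = _
      rw [hM A, prodOp_comp_inlOp]) hU hδ₀ hF₀
  obtain ⟨F₃, hF₃, h₁⟩ := hU₁.approxRel_subset (M := M) (v := inrOp C₀.H C₁.H)
    hM.approximable_inr adjoint_inrOp_comp_inrOp
    (fun A => by
      change M'.proj A ∘L _ = _
      rw [hM A, prodOp_comp_inrOp]) hU hδ₁ hF₁
  exact ⟨M, U, hU, min (δ₀ / 2) (δ₁ / 2), lt_min (half_pos hδ₀) (half_pos hδ₁), F₂ ∪ F₃,
    𝒴.coarse.union_mem hF₂ hF₃, E₀ ∪ E₁, 𝒳.coarse.union_mem hE₀ hE₁,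
    (h₀ E₀).trans (approxRel_mono (min_le_left _ _) Set.subset_union_left Set.subset_union_left),
    (h₁ E₁).trans (approxRel_mono (min_le_right _ _) Set.subset_union_right
      Set.subset_union_right)⟩

end StarFunctor

/-! ## Coarse maps extracted from controlled relations -/

namespace CoarseSpace

variable {CX : CoarseSpace X} {CY : CoarseSpace Y} {R S : Set (Y × X)} {f g : X → Y}

theorem relAsymp_mapGraph (hRS : R ⊆ S)
    (hS : ∀ E ∈ CX.entourages, ∃ G ∈ CY.entourages, ∀ y x y' x', (y, x) ∈ S → (y', x') ∈ S →
      (x, x') ∈ E → (y, y') ∈ G)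
    (hR : ∃ E ∈ CX.entourages, ∀ x, ∃ y x', (y, x') ∈ R ∧ (x', x) ∈ E)
    (hf : ∃ E ∈ CX.entourages, ∀ x, ∃ x', (f x, x') ∈ S ∧ (x', x) ∈ E) :
    RelAsymp CX CY R (mapGraph f) := by
  obtain ⟨E₁, hE₁, hR⟩ := hR
  obtain ⟨E₂, hE₂, hf⟩ := hf
  constructor
  · obtain ⟨G, hG, h⟩ := hS _ (CX.transpose_mem hE₂)
    refine ⟨G, hG, _, CX.diagonal_mem, ?_⟩
    rintro ⟨y, x⟩ hyx
    obtain ⟨x', hx', hxx⟩ := hf x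
    exact ⟨(f x, x), rfl, h y x (f x) x' (hRS hyx) hx' hxx, rfl⟩
  · obtain ⟨G, hG, h⟩ := hS _ (CX.comp_mem hE₂ (CX.transpose_mem hE₁))
    refine ⟨G, hG, _, CX.transpose_mem hE₁, ?_⟩
    rintro ⟨z, x⟩ hz
    obtain rfl : z = f x := hz
    obtain ⟨x', hx', hxx⟩ := hf x
    obtain ⟨y, x₁, hy, hxx₁⟩ := hR x
    exact ⟨(y, x₁), hy, h (f x) x' y x₁ hx' (hRS hy) ⟨x, hxx, hxx₁⟩, hxx₁⟩

theorem isCoarseEmbedding_of_relation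
    (hS : ∀ E ∈ CX.entourages, ∃ G ∈ CY.entourages, ∀ y x y' x', (y, x) ∈ S → (y', x') ∈ S →
      (x, x') ∈ E → (y, y') ∈ G)
    (hS' : ∀ G ∈ CY.entourages, ∃ E ∈ CX.entourages, ∀ y x y' x', (y, x) ∈ S → (y', x') ∈ S →
      (y, y') ∈ G → (x, x') ∈ E)
    (hf : ∃ E ∈ CX.entourages, ∀ x, ∃ x', (f x, x') ∈ S ∧ (x', x) ∈ E) :
    IsCoarseEmbedding CX CY f := by
  obtain ⟨E₂, hE₂, hf⟩ := hf
  constructor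
  · intro E hE
    obtain ⟨G, hG, h⟩ := hS _ (CX.comp_mem hE₂ (CX.comp_mem hE (CX.transpose_mem hE₂)))
    refine CY.mem_of_subset hG ?_
    rintro _ ⟨⟨p, q⟩, hpq, rfl⟩
    obtain ⟨p', hp', hpp⟩ := hf p
    obtain ⟨q', hq', hqq⟩ := hf q
    exact h _ _ _ _ hp' hq' ⟨p, hpp, q, hpq, hqq⟩
  · intro G hG
    obtain ⟨E, hE, h⟩ := hS' G hG
    refine CX.mem_of_subset (CX.comp_mem (CX.transpose_mem hE₂) (CX.comp_mem hE hE₂)) ?_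
    rintro ⟨p, q⟩ hpq
    obtain ⟨p', hp', hpp⟩ := hf p
    obtain ⟨q', hq', hqq⟩ := hf q
    exact ⟨p', hpp, q', h _ _ _ _ hp' hq' hpq, hqq⟩

theorem close_of_relAsymp (hg : IsCoarseMap CX CY g) (hRf : RelAsymp CX CY R (mapGraph f))
    (hRg : RelAsymp CX CY R (mapGraph g)) : Close CX CY f g := by
  obtain ⟨Fa, hFa, Ea, hEa, hf⟩ := hRf.2
  obtain ⟨Fb, hFb, Eb, hEb, hg'⟩ := hRg.1
  intro E hE
  refine CY.mem_of_subset (CY.comp_mem hFa (CY.comp_mem hFb (hg _ (CX.comp_mem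
    (CX.transpose_mem (CX.comp_mem hEa hEb)) hE)))) ?_
  rintro _ ⟨⟨x, x'⟩, hxx, rfl⟩
  obtain ⟨⟨y, x₁⟩, hy, h1, h2⟩ := hf (f x, x) rfl
  obtain ⟨⟨z, x₂⟩, hz, h3, h4⟩ := hg' (y, x₁) hy
  obtain rfl : z = g x₂ := hz
  exact ⟨y, h1, g x₂, h3, ⟨(x₂, x'), ⟨x, ⟨x₁, h2, h4⟩, hxx⟩, rfl⟩⟩

theorem IsCoarseEmbedding.isCoarseEquivMap (hf : IsCoarseEmbedding CX CY f)
    (h : ∃ G ∈ CY.entourages, ∀ y, ∃ x, (y, f x) ∈ G) : IsCoarseEquivMap CX CY f := by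
  obtain ⟨G, hG, h⟩ := h
  choose g hg using h
  have hGt := CY.transpose_mem hG
  refine ⟨hf.1, g, ?_, ?_, ?_⟩
  · intro E hE
    refine CX.mem_of_subset (hf.2 _ (CY.comp_mem hGt (CY.comp_mem hE hG))) ?_
    rintro _ ⟨⟨y, y'⟩, hyy, rfl⟩
    exact ⟨y, hg y, y', hyy, hg y'⟩
  · intro E hE
    refine CY.mem_of_subset (CY.comp_mem hGt hE) ?_
    rintro _ ⟨⟨y, y'⟩, hyy, rfl⟩
    exact ⟨y, hg y, hyy⟩
  · intro E hE
    refine CX.mem_of_subset (hf.2 _ (CY.comp_mem hGt (hf.1 E hE))) ?_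
    rintro _ ⟨⟨x, x'⟩, hxx, rfl⟩
    exact ⟨f x, hg (f x), ⟨(x, x'), hxx, rfl⟩⟩

end CoarseSpace

namespace StarFunctor

variable {𝒳 : LFCMSpace X} {𝒴 : LFCMSpace Y} {F : StarFunctor 𝒳 𝒴}

theorem Implements.exists_mem_approxRel (hfull : F.Full) (hX : 𝒳.coarse.IsCountablyGenerated)
    {C : BundledModule 𝒳} (hC : IsFaithfulMod 𝒳 C.mod) {U : C.H →L[ℂ] (F.obj C).H}
    (hU : F.Implements C U) {δ : ℝ} (hδ0 : 0 < δ) (hδ1 : δ < 1) :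
    ∃ E₀ ∈ 𝒳.coarse.entourages, ∃ E₁ ∈ 𝒳.coarse.entourages, ∀ x, ∃ y x',
      (y, x') ∈ approxRel 𝒳 𝒴 C.mod.proj (F.obj C).mod.proj U δ 𝒴.disc E₀ ∧ (x', x) ∈ E₁ :=
  (hU.conjApprox_adjoint hfull).exists_mem_approxRel_of_faithful hX hC hδ0 hδ1

/-- A map selected from an approximate relation of one faithful module represents the functor. -/
theorem Implements.representsInducedEmbedding (hfull : F.Full) (hfaith : F.Faithful)
    (hX : 𝒳.coarse.IsCountablyGenerated) (hY : 𝒴.coarse.IsCountablyGenerated)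
    {C₀ : BundledModule 𝒳} {U₀ : C₀.H →L[ℂ] (F.obj C₀).H} (hU₀ : F.Implements C₀ U₀)
    {δ₀ : ℝ} (hδ₀ : 0 < δ₀) {F₀ : Set (Y × Y)} (hF₀ : F₀ ∈ 𝒴.coarse.entourages)
    {E₀ E₁ : Set (X × X)} (hE₀ : E₀ ∈ 𝒳.coarse.entourages) (hE₁ : E₁ ∈ 𝒳.coarse.entourages)
    {f : X → Y} (hf : ∀ x, ∃ x',
      (f x, x') ∈ approxRel 𝒳 𝒴 C₀.mod.proj (F.obj C₀).mod.proj U₀ δ₀ F₀ E₀ ∧ (x', x) ∈ E₁) :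
    RepresentsInducedEmbedding F f := by
  intro C hC U hU δ hδ0 hδ1
  obtain ⟨E₂, hE₂, E₃, hE₃, hd⟩ := hU.exists_mem_approxRel hfull hX hC hδ0 hδ1
  refine ⟨𝒴.disc, 𝒴.disc_mem, E₂, hE₂, fun F' hF' hsub E hE hsub' => ?_⟩
  obtain ⟨M, UM, hUM, δ', hδ', F'', hF'', E'', hE'', h₀, h₁⟩ :=
    exists_approxRel_union_subset hfull hfaith hU₀ hU hδ₀ hδ0 hF₀ hF' hE₀ hE
  refine CoarseSpace.relAsymp_mapGraph h₁
    (fun K hK => hUM.conjApprox.approxRel_controlled hY hδ' hF'' hE'' hK) ⟨E₃, hE₃, fun x => ?_⟩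
    ⟨E₁, hE₁, fun x => ?_⟩
  · obtain ⟨y, x', h, hxx⟩ := hd x
    exact ⟨y, x', approxRel_mono le_rfl hsub hsub' h, hxx⟩
  · obtain ⟨x', h, hxx⟩ := hf x
    exact ⟨x', h₀ h, hxx⟩

/-- The embedding induced by an essentially surjective functor is coarsely surjective. -/
theorem _root_.RepresentsInducedEmbedding.exists_near (hfull : F.Full) (hfaith : F.Faithful)
    (hY : 𝒴.coarse.IsCountablyGenerated) {C : BundledModule 𝒳} (hC : IsFaithfulMod 𝒳 C.mod)
    {D : BundledModule 𝒴} (hD : IsFaithfulMod 𝒴 D.mod) (hF : F.EssSurj) {f : X → Y}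
    (hf : RepresentsInducedEmbedding F f) :
    ∃ G ∈ 𝒴.coarse.entourages, ∀ y, ∃ x, (y, f x) ∈ G := by
  obtain ⟨C', u, hu, v, hv, -, huv⟩ := hF D
  obtain ⟨M', hM⟩ := exists_isDirectSum C.mod C'.mod
  set M : BundledModule 𝒳 := BundledModule.ofModule M' with hMdef
  have hMf : IsFaithfulMod 𝒳 M.mod := hC.of_leftInverse hM.approximable_inl
    adjoint_inlOp_comp_inlOp
  set i := F.map (C := C') (D := M) (inrOp C.H C'.H) hM.approximable_inr with hi
  have hii : ContinuousLinearMap.adjoint i ∘L i = ContinuousLinearMap.id ℂ (F.obj C').H :=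
    adjoint_map_comp_map _ adjoint_inrOp_comp_inrOp
  have hFMf : IsFaithfulMod 𝒴 (F.obj M).mod := by
    refine hD.of_leftInverse (v := i ∘L v) (u := u ∘L ContinuousLinearMap.adjoint i)
      ((F.map_approximable _ _).comp hv) ?_
    rw [ContinuousLinearMap.comp_assoc, ← ContinuousLinearMap.comp_assoc _ i v, hii,
      ContinuousLinearMap.id_comp, huv]
  obtain ⟨U, hU⟩ := exists_implements hfull hfaith M
  obtain ⟨F₀, hF₀, E₀, hE₀, hrep⟩ := hf M hMf U hU (1 / 2) (by norm_num) (by norm_num)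
  obtain ⟨F₁, hF₁, F₂, hF₂, hd⟩ := ConjApprox.exists_mem_approxRel_of_faithful
    (C := (F.obj M).mod) (D := M.mod) (U := ContinuousLinearMap.adjoint U) (δ := 1 / 2)
    (by rw [ContinuousLinearMap.adjoint_adjoint]; exact hU.conjApprox) hY hFMf
    (by norm_num) (by norm_num)
  obtain ⟨K, hK, L, -, h⟩ := (hrep (F₀ ∪ F₁) (𝒴.coarse.union_mem hF₀ hF₁) Set.subset_union_left
    (E₀ ∪ 𝒳.disc) (𝒳.coarse.union_mem hE₀ 𝒳.disc_mem) Set.subset_union_left).1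
  refine ⟨_, 𝒴.coarse.comp_mem (𝒴.coarse.transpose_mem hF₂) hK, fun y => ?_⟩
  obtain ⟨x, y', hxy, hyy⟩ := hd y
  obtain ⟨⟨w, z⟩, hw, h1, -⟩ := h (y', x) (approxRel_mono le_rfl Set.subset_union_right
    Set.subset_union_right (mem_approxRel_adjoint.1 hxy))
  obtain rfl : w = f z := hw
  exact ⟨z, y', hyy, h1⟩

end StarFunctor

/-- Any full and faithful *-functor between approximable categories of
countably generated LFCM spaces (containing faithful modules) induces a coarse embedding,
unique up to closeness, to which the approximate relations of all implementing unitaries of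
faithful modules are asymptotic; if the functor is a *-equivalence, the embedding is a
coarse equivalence. -/
theorem starFunctor_induces_coarse_embedding {X Y : Type}
    (𝒳 : LFCMSpace X) (𝒴 : LFCMSpace Y)
    (hX : 𝒳.coarse.IsCountablyGenerated) (hY : 𝒴.coarse.IsCountablyGenerated)
    (hfX : ∃ C : BundledModule 𝒳, IsFaithfulMod 𝒳 C.mod)
    (hfY : ∃ D : BundledModule 𝒴, IsFaithfulMod 𝒴 D.mod)
    (F : StarFunctor 𝒳 𝒴) (hfull : F.Full) (hfaithful : F.Faithful) :
    ∃ f : X → Y, CoarseSpace.IsCoarseEmbedding 𝒳.coarse 𝒴.coarse f ∧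
      RepresentsInducedEmbedding F f ∧
      (∀ g : X → Y, CoarseSpace.IsCoarseEmbedding 𝒳.coarse 𝒴.coarse g →
        RepresentsInducedEmbedding F g → CoarseSpace.Close 𝒳.coarse 𝒴.coarse f g) ∧
      (F.EssSurj → CoarseSpace.IsCoarseEquivMap 𝒳.coarse 𝒴.coarse f) := by
  obtain ⟨C, hC⟩ := hfX
  obtain ⟨D, hD⟩ := hfY
  obtain ⟨U, hU⟩ := StarFunctor.exists_implements hfull hfaithful C
  have h0 : (0 : ℝ) < 1 / 2 := by norm_num
  have h1 : (1 / 2 : ℝ) < 1 := by norm_num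
  obtain ⟨E₀, hE₀, E₁, hE₁, hd⟩ := hU.exists_mem_approxRel hfull hX hC h0 h1
  choose f hf using hd
  have hrep := hU.representsInducedEmbedding hfull hfaithful hX hY h0 𝒴.disc_mem hE₀ hE₁ hf
  have hemb : CoarseSpace.IsCoarseEmbedding 𝒳.coarse 𝒴.coarse f := by
    refine CoarseSpace.isCoarseEmbedding_of_relation
      (fun E hE => hU.conjApprox.approxRel_controlled hY h0 𝒴.disc_mem hE₀ hE)
      (fun G hG => ?_) ⟨E₁, hE₁, hf⟩
    obtain ⟨E, hE, h⟩ := (hU.conjApprox_adjoint hfull).approxRel_controlled hX h0 hE₀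
      𝒴.disc_mem hG
    exact ⟨E, hE, fun y x y' x' hyx hyx' => h x y x' y' (mem_approxRel_adjoint.2 hyx)
      (mem_approxRel_adjoint.2 hyx')⟩
  refine ⟨f, hemb, hrep, fun g hg hgrep => ?_, fun hF =>
    hemb.isCoarseEquivMap (hrep.exists_near hfull hfaithful hY hC hD hF)⟩
  obtain ⟨F₁, hF₁, E₂, hE₂, h₁⟩ := hrep C hC U hU _ h0 h1
  obtain ⟨F₂, hF₂, E₃, hE₃, h₂⟩ := hgrep C hC U hU _ h0 h1
  have hF := 𝒴.coarse.union_mem hF₁ hF₂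
  have hE := 𝒳.coarse.union_mem hE₂ hE₃
  exact CoarseSpace.close_of_relAsymp hg.1
    (h₁ _ hF Set.subset_union_left _ hE Set.subset_union_left)
    (h₂ _ hF Set.subset_union_right _ hE Set.subset_union_right)
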